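/- arXiv:2206.00228 — 10 statements merged into one kernel-verified Lean document; each statement's English description precedes it below -/
import Mathlib

section
/- Let n0, n1 be positive integers. For a one-layer fully connected ReLU neural network with input dimension n0 and n1 neurons, the maximal number of linear regions equals \sum_{i=0}^{n0} \binom{n1}{i}. Precisely: (a) for every weight matrix W \in \mathbb{R}^{n1\times n0} and every bias vector b \in \mathbb{R}^{n1}, the number of sign patterns P \in \{-1,+1\}^{n1} for which the set {x \in \mathbb{R}^{n0} : P_j\cdot(\langle W_j, x\rangle + b_j) > 0 for all j = 1,...,n1} is nonempty is at most \sum_{i=0}^{n0} \binom{n1}{i}, where W_j is the j-th row of W; and (b) there exist W and b for which this number equals \sum_{i=0}^{n0} \binom{n1}{i}. -/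
open Finset in
theorem nn_not_shatter {n0 n1 : ℕ} (W : Matrix (Fin n1) (Fin n0) ℝ) (b : Fin n1 → ℝ)
    (s : Finset (Fin n1))
    (h : ∀ t ⊆ s, ∃ x : Fin n0 → ℝ, ∀ j ∈ s, (j ∈ t → 0 < (∑ i, W j i * x i) + b j) ∧
      (j ∉ t → (∑ i, W j i * x i) + b j < 0)) : s.card ≤ n0 := by
  classical
  by_contra hs
  have hdep : ¬ LinearIndependent ℝ (fun j : s => W j.1) := by
    intro hl
    have := hl.fintype_card_le_finrank
    simp at this
    omega
  rw [Fintype.not_linearIndependent_iff] at hdep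
  obtain ⟨g, hg, j0, hj0⟩ := hdep
  have key : ∀ g : s → ℝ, ∑ j, g j • W j.1 = 0 → g j0 ≠ 0 → 0 < ∑ j, g j * b j.1 := by
    intro g hg hj0
    obtain ⟨x, hx⟩ := h ((univ.filter (fun j : s => 0 < g j)).map (Function.Embedding.subtype _))
      (by intro a ha; simp at ha; exact ha.1)
    have e : ∑ j, g j * b j.1 = ∑ j : s, g j * ((∑ i, W j.1 i * x i) + b j.1) := by
      simp only [mul_add, sum_add_distrib]
      have : ∑ j : s, g j * ∑ i, W j.1 i * x i = 0 := by
        simp only [mul_sum]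
        rw [sum_comm]
        apply sum_eq_zero
        intro i _
        have := congrFun hg i
        simp [-univ_eq_attach] at this
        simp only [← mul_assoc]
        rw [← sum_mul, this, zero_mul]
      rw [this, zero_add]
    rw [e]
    have hp : ∀ j : s, g j ≠ 0 → 0 < g j * ((∑ i, W j.1 i * x i) + b j.1) := by
      intro j hj
      rcases lt_or_gt_of_ne hj with hj | hj
      · exact mul_pos_of_neg_of_neg hj ((hx j j.2).2 (by simp [hj.le]))
      · exact mul_pos hj ((hx j j.2).1 (by simp [hj]))
    apply sum_pos'
    · intro j _
      by_cases hj : g j = 0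
      · simp [hj]
      · exact (hp j hj).le
    · exact ⟨j0, mem_univ _, hp j0 hj0⟩
  have h1 := key g hg hj0
  have h2 := key (fun j => - g j) (by simp only [neg_smul, sum_neg_distrib]; rw [hg, neg_zero]) (by simpa using hj0)
  simp only [neg_mul, sum_neg_distrib] at h2
  linarith

open Finset in
theorem nn_card_le (n0 n1 : ℕ) : (univ.filter (fun s : Finset (Fin n1) => s.card ≤ n0)).card
    = ∑ i ∈ Finset.range (n0 + 1), n1.choose i := by
  classical
  rw [card_eq_sum_card_fiberwise (f := card) (t := range (n0+1))]
  · apply sum_congr rfl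
    intro k hk
    have : filter (fun a : Finset (Fin n1) => a.card = k) (univ.filter (fun s => s.card ≤ n0))
      = powersetCard k univ := by
      ext a
      simp at hk
      simp [mem_powersetCard]
      omega
    rw [this]; simp
  · intro a ha
    simp at ha ⊢
    omega

def nnSet {n0 n1 : ℕ} (W : Matrix (Fin n1) (Fin n0) ℝ) (b : Fin n1 → ℝ) : Set (Fin n1 → ℝ) :=
  {P : Fin n1 → ℝ | (∀ j, P j = 1 ∨ P j = -1) ∧
          ∃ x : Fin n0 → ℝ, ∀ j, P j * ((∑ i, W j i * x i) + b j) > 0}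

theorem nnSet_finite {n0 n1 : ℕ} (W : Matrix (Fin n1) (Fin n0) ℝ) (b : Fin n1 → ℝ) :
    (nnSet W b).Finite := by
  apply (Set.Finite.pi' (t := fun _ : Fin n1 => ({1, -1} : Set ℝ)) (fun _ => by simp)).subset
  intro P hP j
  simpa using hP.1 j

open Finset in
theorem nn_upper {n0 n1 : ℕ} (W : Matrix (Fin n1) (Fin n0) ℝ) (b : Fin n1 → ℝ) :
    (nnSet W b).ncard ≤ ∑ i ∈ Finset.range (n0 + 1), n1.choose i := by
  classical
  let A : Finset (Finset (Fin n1)) := univ.filter (fun t => ∃ x : Fin n0 → ℝ, ∀ j,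
    (j ∈ t → 0 < (∑ i, W j i * x i) + b j) ∧ (j ∉ t → (∑ i, W j i * x i) + b j < 0))
  have h1 : (nnSet W b).ncard ≤ (A : Set (Finset (Fin n1))).ncard := by
    apply Set.ncard_le_ncard_of_injOn (fun P => univ.filter (fun j => P j = 1))
    · rintro P ⟨hP, x, hx⟩
      simp only [A, coe_filter, mem_univ, true_and, Set.mem_ofPred_eq, mem_filter]
      refine ⟨x, fun j => ⟨fun h => ?_, fun h => ?_⟩⟩
      · have := hx j
        rw [h] at this; linarith
      · have := hx j
        rw [(hP j).resolve_left h] at this; linarith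
    · intro P hP Q hQ h
      funext j
      have := congrArg (fun s => j ∈ s) h
      simp at this
      rcases hP.1 j with h1 | h1 <;> rcases hQ.1 j with h2 | h2 <;> simp_all
  rw [Set.ncard_coe_finset] at h1
  refine h1.trans ((card_le_card_shatterer A).trans ?_)
  rw [← nn_card_le]
  apply card_le_card
  intro s hs
  rw [mem_shatterer] at hs
  simp only [mem_filter, mem_univ, true_and]
  apply nn_not_shatter W b
  intro t ht
  obtain ⟨u, hu, rfl⟩ := hs ht
  simp only [A, mem_filter, mem_univ, true_and] at hu
  obtain ⟨x, hx⟩ := hu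
  exact ⟨x, fun j hj => ⟨fun h => (hx j).1 (by simp at h; exact h.2),
    fun h => (hx j).2 (by simpa [hj] using h)⟩⟩

open Finset in
def nnPat {n1 : ℕ} (S : Finset (Fin n1)) (m : ℕ) : ℝ := ∏ i ∈ S, if m ≤ i.val then -1 else 1

open Finset in
theorem nnPat_pm {n1 : ℕ} (S : Finset (Fin n1)) (m : ℕ) : nnPat S m = 1 ∨ nnPat S m = -1 := by
  unfold nnPat
  apply prod_induction (p := fun y : ℝ => y = 1 ∨ y = -1)
  · rintro a b (rfl | rfl) (rfl | rfl) <;> simp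
  · simp
  · intro i _; split_ifs <;> simp

open Finset in
theorem nnPat_mem {n1 : ℕ} (S : Finset (Fin n1)) (i : Fin n1) :
    nnPat S i = nnPat S (i + 1) * (if i ∈ S then -1 else 1) := by
  classical
  have : (if i ∈ S then (-1 : ℝ) else 1) = ∏ k ∈ S, if k = i then -1 else 1 := by
    rw [prod_ite_eq']
  unfold nnPat
  rw [this, ← prod_mul_distrib]
  apply prod_congr rfl
  intro k _
  simp only [Fin.ext_iff]
  split_ifs <;> first | omega | simp

theorem nnPat_inj {n1 : ℕ} (S T : Finset (Fin n1)) (h : ∀ j : Fin n1, nnPat S j = nnPat T j) :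
    S = T := by
  have h' : ∀ m : ℕ, nnPat S m = nnPat T m := by
    intro m
    by_cases hm : m < n1
    · exact h ⟨m, hm⟩
    · have : ∀ U : Finset (Fin n1), nnPat U m = 1 := by
        intro U
        apply Finset.prod_eq_one
        intro i _
        rw [if_neg]; omega
      rw [this, this]
  ext i
  have h1 := nnPat_mem S i
  have h2 := nnPat_mem T i
  rw [h' i, h' (i + 1), h2] at h1
  rcases nnPat_pm T (i + 1) with h3 | h3 <;> rw [h3] at h1 <;> split_ifs at h1 <;>
    first | tauto | norm_num at h1

open Polynomial in
theorem nn_attain {n0 n1 : ℕ} (S : Finset (Fin n1)) (hS : S.card ≤ n0) :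
    ∃ x : Fin n0 → ℝ, ∀ j : Fin n1,
      nnPat S j * ((∑ i : Fin n0, (j : ℝ) ^ (i : ℕ) * x i) + (j : ℝ) ^ n0) > 0 := by
  let p : ℝ[X] := (∏ i ∈ S, (X - C ((i : ℝ) + 1/2))) * (X - C (-1)) ^ (n0 - S.card)
  have hm1 : (∏ i ∈ S, (X - C ((i : ℝ) + 1/2))).Monic :=
    monic_prod_of_monic _ _ (fun i _ => monic_X_sub_C _)
  have hm2 : ((X - C (-1 : ℝ)) ^ (n0 - S.card)).Monic := (monic_X_sub_C _).pow _
  have hm : p.Monic := hm1.mul hm2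
  have hd : p.natDegree = n0 := by
    rw [hm1.natDegree_mul hm2, natDegree_prod_of_monic _ _ (fun i _ => monic_X_sub_C _),
      (monic_X_sub_C (-1 : ℝ)).natDegree_pow]
    simp only [natDegree_X_sub_C, Finset.sum_const, smul_eq_mul, mul_one]
    omega
  refine ⟨fun i => p.coeff i, fun j => ?_⟩
  have he : (∑ i : Fin n0, (j : ℝ) ^ (i : ℕ) * p.coeff i) + (j : ℝ) ^ n0 = p.eval (j : ℝ) := by
    rw [eval_eq_sum_range, hd, Finset.sum_range_succ, Finset.sum_range]
    have : p.coeff n0 = 1 := by rw [← hd]; exact hm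
    rw [this, one_mul]
    simp only [mul_comm]
  rw [he]
  simp only [p, eval_mul, eval_prod, eval_pow, eval_sub, eval_X, eval_C]
  rw [← mul_assoc, nnPat, ← Finset.prod_mul_distrib]
  apply mul_pos
  · apply Finset.prod_pos
    intro i _
    split_ifs with h
    · have : (j : ℝ) ≤ i := by exact_mod_cast h
      linarith
    · have : (i : ℝ) + 1 ≤ j := by exact_mod_cast (not_le.mp h)
      linarith
  · apply pow_pos
    have : (0 : ℝ) ≤ j := by positivity
    linarith


/-- For a one-layer fully connected ReLU neural network with input
dimension `n0` and `n1` neurons, the maximal number of linear regions equals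
`∑_{i=0}^{n0} (n1 choose i)`:
(a) for every weight matrix `W` and bias `b` the number of nonempty sign-pattern
regions is at most this sum, and (b) some `W, b` attain it. -/
theorem one_layer_nn_max_linear_regions (n0 n1 : ℕ) (hn0 : 0 < n0) (hn1 : 0 < n1) :
    (∀ (W : Matrix (Fin n1) (Fin n0) ℝ) (b : Fin n1 → ℝ),
      Set.ncard {P : Fin n1 → ℝ | (∀ j, P j = 1 ∨ P j = -1) ∧
          ∃ x : Fin n0 → ℝ, ∀ j, P j * ((∑ i, W j i * x i) + b j) > 0}
        ≤ ∑ i ∈ Finset.range (n0 + 1), n1.choose i) ∧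
    (∃ (W : Matrix (Fin n1) (Fin n0) ℝ) (b : Fin n1 → ℝ),
      Set.ncard {P : Fin n1 → ℝ | (∀ j, P j = 1 ∨ P j = -1) ∧
          ∃ x : Fin n0 → ℝ, ∀ j, P j * ((∑ i, W j i * x i) + b j) > 0}
        = ∑ i ∈ Finset.range (n0 + 1), n1.choose i) := by

  refine ⟨fun W b => nn_upper W b, fun j i => (j : ℝ) ^ (i : ℕ), fun j => (j : ℝ) ^ n0, ?_⟩
  apply le_antisymm (nn_upper _ _)
  rw [← nn_card_le, ← Set.ncard_coe_finset]
  refine Set.ncard_le_ncard_of_injOn (fun S j => nnPat S (j : Fin n1)) ?_ ?_ (nnSet_finite _ _)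
  · intro S hS
    exact ⟨fun j => nnPat_pm S j, nn_attain S (by simpa using hS)⟩
  · intro S _ T _ h
    exact nnPat_inj S T (fun j => congrFun h j)
end

section
/- Let \hat{A} \in \mathbb{R}^{D\times D}, W \in \mathbb{R}^{N\times N'}, b \in \mathbb{R}^{N'}. Let \tilde{A} \in \mathbb{R}^{D^*\times D} be the matrix of pairwise-distinct rows of \hat{A}, let \alpha_i be the i-th row of \tilde{A} and w_j the j-th column of W, and let V_{ij} \subseteq \mathbb{R}^{D\times N} be the linear span of the rank-one matrix \alpha_i^T w_j^T. Define K = {k : [D^*]\times[N'] \to \mathbb{N} such that for every subset S \subseteq [D^*]\times[N'], \sum_{(i,j)\in S} k_{ij} \le \dim(\sum_{(i,j)\in S} V_{ij})}. Then the number of linear regions of the one-layer GCN with parameters (W, b) satisfies R_{\mathcal{N},(W,b)} \le \#K. -/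
/-- The number of linear regions of the one-layer GCN with adjacency `Ahat`,
weight `W` and bias `b`: the number of sign patterns `P ∈ {±1}^{D×N'}` whose
region `{X : ∀ i j, P i j * ((Ahat X W) i j + b j) > 0}` is nonempty. -/
noncomputable def oneLayerGCNRegions (D Nin Nout : ℕ) (Ahat : Matrix (Fin D) (Fin D) ℝ)
    (W : Matrix (Fin Nin) (Fin Nout) ℝ) (b : Fin Nout → ℝ) : ℕ :=
  Set.ncard {P : Fin D → Fin Nout → ℝ |
    (∀ i j, P i j = 1 ∨ P i j = -1) ∧
    ∃ X : Matrix (Fin D) (Fin Nin) ℝ, ∀ i j, P i j * ((Ahat * X * W) i j + b j) > 0}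

open Finset in
lemma gcn_aux_sum {D N Ds N' : ℕ} (tA : Matrix (Fin Ds) (Fin D) ℝ) (W : Matrix (Fin N) (Fin N') ℝ)
    (X : Matrix (Fin D) (Fin N) ℝ) (s : Finset (Fin Ds × Fin N')) (c : Fin Ds × Fin N' → ℝ)
    (h : ∑ p ∈ s, c p • Matrix.vecMulVec (tA p.1) (fun a : Fin N => W a p.2) = 0) :
    ∑ p ∈ s, c p * (tA * X * W) p.1 p.2 = 0 := by
  have key : ∀ p : Fin Ds × Fin N', (tA * X * W) p.1 p.2 =
      ∑ a, ∑ d, (Matrix.vecMulVec (tA p.1) (fun a : Fin N => W a p.2)) d a * X d a := by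
    intro p
    simp only [Matrix.mul_apply, Matrix.vecMulVec_apply, Finset.sum_mul]
    refine Finset.sum_congr rfl fun a _ => Finset.sum_congr rfl fun d _ => by ring
  simp only [key, Finset.mul_sum]
  rw [Finset.sum_comm]
  refine Finset.sum_eq_zero fun a _ => ?_
  rw [Finset.sum_comm]
  refine Finset.sum_eq_zero fun d _ => ?_
  have h2 := congrFun (congrFun h d) a
  simp only [Matrix.sum_apply, Matrix.smul_apply, smul_eq_mul, Matrix.zero_apply] at h2
  simp only [← mul_assoc, ← Finset.sum_mul]
  rw [h2, zero_mul]

lemma gcn_aux_pos {ι : Type*} (s : Finset ι) (c f : ι → ℝ) (i : ι) (hi : i ∈ s) (hci : c i ≠ 0)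
    (hp : ∀ p ∈ s, 0 < c p → 0 < f p) (hn : ∀ p ∈ s, c p < 0 → f p < 0) :
    0 < ∑ p ∈ s, c p * f p := by
  refine Finset.sum_pos' (fun p hps => ?_) ⟨i, hi, ?_⟩
  · rcases lt_trichotomy (c p) 0 with h | h | h
    · exact (mul_pos_of_neg_of_neg h (hn p hps h)).le
    · simp [h]
    · exact (mul_pos h (hp p hps h)).le
  · rcases lt_or_gt_of_ne hci with h | h
    · exact mul_pos_of_neg_of_neg h (hn i hi h)
    · exact mul_pos h (hp i hi h)

/-- the number of linear regions of a one-layer GCN is at most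
`#K`, where `K` is the set of maps `k : [D*]×[N'] → ℕ` with
`∑_{(i,j)∈S} k ij ≤ dim (∑_{(i,j)∈S} V ij)` for all subsets `S`, and `V ij` is
the span of the rank-one matrix `(row i of Ã)ᵀ (column j of W)ᵀ`. -/
theorem one_layer_gcn_upper_bound
    (D Dstar N N' : ℕ)
    (Ahat : Matrix (Fin D) (Fin D) ℝ)
    (tA : Matrix (Fin Dstar) (Fin D) ℝ)
    (htA1 : ∀ d : Fin D, ∃ i : Fin Dstar, Ahat d = tA i)
    (htA2 : ∀ i : Fin Dstar, ∃ d : Fin D, tA i = Ahat d)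
    (htA3 : Function.Injective (fun i : Fin Dstar => tA i))
    (W : Matrix (Fin N) (Fin N') ℝ) (b : Fin N' → ℝ) :
    oneLayerGCNRegions D N N' Ahat W b ≤
      Set.ncard {k : Fin Dstar × Fin N' → ℕ |
        ∀ S : Finset (Fin Dstar × Fin N'),
          ∑ p ∈ S, k p ≤
            Module.finrank ℝ
              ↥(⨆ p ∈ S, (Submodule.span ℝ
                {Matrix.vecMulVec (tA p.1) (fun a : Fin N => W a p.2)} :
                Submodule ℝ (Matrix (Fin D) (Fin N) ℝ)))} := by
  classical
  set v : Fin Dstar × Fin N' → Matrix (Fin D) (Fin N) ℝ :=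
    fun p => Matrix.vecMulVec (tA p.1) (fun a : Fin N => W a p.2) with hv
  set K := {k : Fin Dstar × Fin N' → ℕ | ∀ S : Finset (Fin Dstar × Fin N'),
          ∑ p ∈ S, k p ≤ Module.finrank ℝ
              ↥(⨆ p ∈ S, (Submodule.span ℝ {v p} :
                Submodule ℝ (Matrix (Fin D) (Fin N) ℝ)))} with hK
  let f : Fin Dstar × Fin N' → Matrix (Fin D) (Fin N) ℝ → ℝ :=
    fun p X => (tA * X * W) p.1 p.2 + b p.2
  let A : Finset (Finset (Fin Dstar × Fin N')) :=
    Finset.univ.filter fun s => ∃ X, (∀ p ∈ s, 0 < f p X) ∧ ∀ p, p ∉ s → f p X < 0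
  choose τ hτ using htA1
  choose σ hσ using htA2
  have hf : ∀ d j X, (Ahat * X * W) d j + b j = f (τ d, j) X := by
    intro d j X
    simp only [f, Matrix.mul_apply, hτ]
  have hf2 : ∀ p X, f p X = (Ahat * X * W) (σ p.1) p.2 + b p.2 := by
    intro p X
    simp only [f, Matrix.mul_apply, hσ]
  -- regions at most card A
  have h1 : oneLayerGCNRegions D N N' Ahat W b ≤ A.card := by
    unfold oneLayerGCNRegions
    rw [← Set.ncard_coe_finset A]
    refine (Set.ncard_le_ncard (t := (fun (s : Finset (Fin Dstar × Fin N')) (d : Fin D)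
      (j : Fin N') => if (τ d, j) ∈ s then (1 : ℝ) else -1) '' (A : Set _)) ?_
      (A.finite_toSet.image _)).trans (Set.ncard_image_le A.finite_toSet)
    rintro P ⟨hP, X, hX⟩
    refine ⟨Finset.univ.filter fun p => 0 < f p X, ?_, ?_⟩
    · simp only [A, Finset.coe_filter, Finset.mem_univ, true_and, Set.mem_ofPred_eq,
        Finset.mem_filter]
      refine ⟨X, fun p hp => hp, fun p hp => ?_⟩
      refine lt_of_le_of_ne (not_lt.mp hp) fun h0 => ?_
      have := hX (σ p.1) p.2
      rw [← hf2, h0] at this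
      simp at this
    · funext d j
      have := hX d j
      rw [hf] at this
      simp only [Finset.mem_filter, Finset.mem_univ, true_and]
      rcases hP d j with h | h <;> rw [h] at this ⊢
      · rw [if_pos (by linarith)]
      · rw [if_neg (by linarith)]
  -- shattered sets are independent
  have h2 : ∀ s ∈ A.shatterer, LinearIndepOn ℝ v (s : Set (Fin Dstar × Fin N')) := by
    intro s hs
    rw [Finset.mem_shatterer] at hs
    rw [linearIndepOn_finset_iff]
    intro c hc
    by_contra! hne
    obtain ⟨i, hi, hci⟩ := hne
    have real : ∀ t ⊆ s, ∃ X, ∀ p ∈ s, (p ∈ t → 0 < f p X) ∧ (p ∉ t → f p X < 0) := by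
      intro t ht
      obtain ⟨u, hu, hut⟩ := hs ht
      obtain ⟨X, hX1, hX2⟩ := (Finset.mem_filter.mp hu).2
      refine ⟨X, fun p hp => ⟨fun hpt => hX1 p ?_, fun hpt => hX2 p fun hpu => hpt ?_⟩⟩
      · rw [← hut] at hpt
        exact (Finset.mem_inter.mp hpt).2
      · rw [← hut]
        exact Finset.mem_inter.mpr ⟨hp, hpu⟩
    have hsum : ∀ X, ∑ p ∈ s, c p * f p X = ∑ p ∈ s, c p * b p.2 := by
      intro X
      have := gcn_aux_sum tA W X s c hc
      simp only [f, mul_add, Finset.sum_add_distrib, this, zero_add]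
    obtain ⟨X, hX⟩ := real (s.filter fun p => 0 < c p) (Finset.filter_subset _ _)
    obtain ⟨Y, hY⟩ := real (s.filter fun p => c p < 0) (Finset.filter_subset _ _)
    have e1 := gcn_aux_pos s c (fun p => f p X) i hi hci
      (fun p hp h => (hX p hp).1 (by simp [hp, h]))
      (fun p hp h => (hX p hp).2 (by simp [h.le]))
    have e2 := gcn_aux_pos s (fun p => - c p) (fun p => f p Y) i hi (neg_ne_zero.mpr hci)
      (fun p hp h => (hY p hp).1 (by simp only [Finset.mem_filter]; exact ⟨hp, by linarith⟩))
      (fun p hp h => (hY p hp).2 (by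
        simp only [Finset.mem_filter]; rintro ⟨-, h'⟩; linarith))
    simp only [neg_mul, Finset.sum_neg_distrib] at e2
    rw [hsum] at e1 e2
    linarith
  have hKfin : K.Finite := by
    refine (Set.finite_Icc (0 : Fin Dstar × Fin N' → ℕ)
      (fun _ => Module.finrank ℝ (Matrix (Fin D) (Fin N) ℝ))).subset fun k hk => ⟨?_, ?_⟩
    · intro p; exact Nat.zero_le _
    · intro p
      have := hk {p}
      rw [Finset.sum_singleton] at this
      exact this.trans (Submodule.finrank_le _)
  refine h1.trans ((Finset.card_le_card_shatterer A).trans ?_)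
  rw [← Set.ncard_coe_finset]
  refine Set.ncard_le_ncard_of_injOn (fun s p => if p ∈ s then 1 else 0) ?_ ?_ hKfin
  · intro s hs S
    have hli := (h2 s hs).mono (t := ((S ∩ s : Finset _) : Set _)) (by
      intro x hx; exact (Finset.mem_inter.mp hx).2)
    have hcard := finrank_span_eq_card (R := ℝ) 
      (b := fun x : ((S ∩ s : Finset (Fin Dstar × Fin N')) : Set (Fin Dstar × Fin N')) => v x)
      hli
    rw [Finset.sum_ite_mem, Finset.sum_const, smul_eq_mul, mul_one]
    have e : Fintype.card ((S ∩ s : Finset _) : Set (Fin Dstar × Fin N')) = (S ∩ s).card := by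
      rw [← Set.toFinset_card, Finset.toFinset_coe]
    rw [← e, ← hcard]
    refine Submodule.finrank_mono (Submodule.span_le.mpr ?_)
    rintro _ ⟨⟨x, hx⟩, rfl⟩
    have hxS : x ∈ S := (Finset.mem_inter.mp hx).1
    exact (le_iSup₂_of_le (f := fun p (_ : p ∈ S) => Submodule.span ℝ {v p}) x hxS le_rfl)
      (Submodule.mem_span_singleton_self _)
  · intro s _ t _ hst
    ext p
    have := congrFun hst p
    by_cases hs : p ∈ s <;> by_cases ht : p ∈ t <;> simp [hs, ht] at this ⊢
end

section
/- Let \hat{A} \in \mathbb{R}^{D\times D} and W \in \mathbb{R}^{N\times N'}, let \tilde{A} \in \mathbb{R}^{D^*\times D} be the matrix of pairwise-distinct rows of \hat{A}, and assume the rows of \tilde{A} are linearly independent (rank(\tilde{A}) = D^*). Let \alpha_i be the i-th row of \tilde{A}, w_j the j-th column of W, V_{ij} the span of \alpha_i^T w_j^T in \mathbb{R}^{D\times N}, and K = {k : [D^*]\times[N'] \to \mathbb{N} such that for every subset S \subseteq [D^*]\times[N'], \sum_{(i,j)\in S} k_{ij} \le \dim(\sum_{(i,j)\in S} V_{ij})}.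 If N \le N' and every N columns of W are linearly independent, then \#K = (\sum_{i=0}^{N} \binom{N'}{i})^{D^*}. -/
theorem aux_li (D Dstar N N' : ℕ)
    (tA : Matrix (Fin Dstar) (Fin D) ℝ)
    (hrows : LinearIndependent ℝ (fun i : Fin Dstar => tA i))
    (W : Matrix (Fin N) (Fin N') ℝ)
    (hNN : N ≤ N')
    (hW : ∀ I : Finset (Fin N'), I.card = N →
      LinearIndependent ℝ (fun j : {x // x ∈ I} => fun a : Fin N => W a j))
    (f : Fin Dstar → Finset (Fin N')) (hf : ∀ i, (f i).card ≤ N)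
    (T : Finset (Fin Dstar × Fin N')) (hT : ∀ p ∈ T, p.2 ∈ f p.1) :
    LinearIndependent ℝ (fun p : {x // x ∈ T} =>
      (Matrix.vecMulVec (tA p.1.1) (fun a : Fin N => W a p.1.2) :
        Matrix (Fin D) (Fin N) ℝ)) := by
  classical
  rw [Fintype.linearIndependent_iff]
  intro g hg
  let c : Fin Dstar → Fin N' → ℝ := fun i j => if h : (i, j) ∈ T then g ⟨(i, j), h⟩ else 0
  have hc0 : ∀ i j, j ∉ f i → c i j = 0 := by
    intro i j hj
    have : (i, j) ∉ T := fun h => hj (hT _ h)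
    simp [c, this]
  have hsum : ∀ (d : Fin D) (a : Fin N), ∑ i, (∑ j, c i j * W a j) * tA i d = 0 := by
    intro d a
    have h1 := congrFun (congrFun hg d) a
    rw [Matrix.sum_apply] at h1
    simp only [Matrix.smul_apply, Matrix.vecMulVec_apply, smul_eq_mul, Matrix.zero_apply] at h1
    rw [← h1]
    simp_rw [Finset.sum_mul]
    rw [← Finset.sum_product', Finset.univ_product_univ]
    rw [← Finset.sum_subset (Finset.subset_univ T)]
    · rw [← Finset.sum_coe_sort T]
      refine Finset.sum_congr rfl fun p _ => ?_
      have : c p.1.1 p.1.2 = g p := by simp [c]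
      rw [this]; ring
    · intro p _ hp
      have : c p.1 p.2 = 0 := by simp [c, hp]
      rw [this]; ring
  have hz : ∀ (a : Fin N) (i : Fin Dstar), ∑ j, c i j * W a j = 0 := by
    intro a
    refine Fintype.linearIndependent_iff.1 hrows (fun i => ∑ j, c i j * W a j) ?_
    ext d
    have := hsum d a
    simpa [Finset.sum_apply] using this
  have hc : ∀ i j, c i j = 0 := by
    intro i j
    by_cases hj : j ∈ f i
    swap
    · exact hc0 i j hj
    obtain ⟨I, hI, hIc⟩ := Finset.exists_superset_card_eq (hf i) (by simpa using hNN)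
    have := Fintype.linearIndependent_iff.1 (hW I hIc) (fun j => c i j) (by
      ext a
      have h2 := hz a i
      rw [← Finset.sum_subset (Finset.subset_univ I), ← Finset.sum_coe_sort I] at h2
      · simpa [Finset.sum_apply] using h2
      · intro x _ hx
        rw [hc0 i x (fun h => hx (hI h)), zero_mul])
    exact this ⟨j, hI hj⟩
  intro p
  have := hc p.1.1 p.1.2
  simpa [c] using this

theorem aux_count (N N' : ℕ) :
    (Finset.univ.filter (fun s : Finset (Fin N') => s.card ≤ N)).card
      = ∑ i ∈ Finset.range (N + 1), N'.choose i := by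
  classical
  rw [Finset.card_eq_sum_card_fiberwise (f := Finset.card) (t := Finset.range (N + 1))]
  · refine Finset.sum_congr rfl fun i hi => ?_
    have : (Finset.univ.filter (fun s : Finset (Fin N') => s.card ≤ N)).filter
        (fun s => s.card = i) = Finset.powersetCard i Finset.univ := by
      ext s
      simp only [Finset.mem_filter, Finset.mem_univ, true_and, Finset.mem_powersetCard,
        Finset.subset_univ]
      have := Finset.mem_range.1 hi
      constructor
      · exact fun h => h.2
      · exact fun h => ⟨by omega, h⟩
    rw [this]; simp
  · intro s hs
    simp at hs ⊢
    omega


/-- with `Ã` the matrix of pairwise-distinct rows of `Â`, rows of `Ã`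
linearly independent, `N ≤ N'` and every `N` columns of `W` linearly independent,
the set `K = {k : [D*]×[N'] → ℕ | ∀ S, ∑_{(i,j)∈S} k ij ≤ dim (∑_{(i,j)∈S} V ij)}`
has exactly `(∑_{i=0}^{N} (N' choose i))^{D*}` elements, where `V ij` is the span
of `(row i of Ã)ᵀ (column j of W)ᵀ`. -/
theorem card_K_of_generic_columns
    (D Dstar N N' : ℕ)
    (Ahat : Matrix (Fin D) (Fin D) ℝ)
    (tA : Matrix (Fin Dstar) (Fin D) ℝ)
    (htA1 : ∀ d : Fin D, ∃ i : Fin Dstar, Ahat d = tA i)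
    (htA2 : ∀ i : Fin Dstar, ∃ d : Fin D, tA i = Ahat d)
    (htA3 : Function.Injective (fun i : Fin Dstar => tA i))
    (hrows : LinearIndependent ℝ (fun i : Fin Dstar => tA i))
    (W : Matrix (Fin N) (Fin N') ℝ)
    (hNN : N ≤ N')
    (hW : ∀ I : Finset (Fin N'), I.card = N →
      LinearIndependent ℝ (fun j : {x // x ∈ I} => fun a : Fin N => W a j)) :
    Set.ncard {k : Fin Dstar × Fin N' → ℕ |
        ∀ S : Finset (Fin Dstar × Fin N'),
          ∑ p ∈ S, k p ≤
            Module.finrank ℝ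
              ↥(⨆ p ∈ S, (Submodule.span ℝ
                {Matrix.vecMulVec (tA p.1) (fun a : Fin N => W a p.2)} :
                Submodule ℝ (Matrix (Fin D) (Fin N) ℝ)))}
      = (∑ i ∈ Finset.range (N + 1), N'.choose i) ^ Dstar := by
  classical
  let F : (Fin Dstar → Finset (Fin N')) → (Fin Dstar × Fin N' → ℕ) :=
    fun f p => if p.2 ∈ f p.1 then 1 else 0
  have hF : Function.Injective F := by
    intro f g h
    ext i j
    have := congrFun h (i, j)
    by_cases h1 : j ∈ f i <;> by_cases h2 : j ∈ g i <;> simp_all [F]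
  rw [← aux_count, ← Fintype.card_piFinset_const, ← Set.ncard_coe_finset,
    ← Set.ncard_image_of_injective _ hF]
  congr 1
  ext k
  simp only [Set.mem_ofPred_eq, Set.mem_image, Finset.mem_coe, Fintype.mem_piFinset,
    Finset.mem_filter, Finset.mem_univ, true_and]
  constructor
  · intro hk
    have h1 : ∀ p, k p ≤ 1 := by
      intro p
      have := hk {p}
      rw [Finset.sum_singleton] at this
      refine this.trans (le_trans (Submodule.finrank_mono (t := Submodule.span ℝ
        {(Matrix.vecMulVec (tA p.1) (fun a : Fin N => W a p.2) :
          Matrix (Fin D) (Fin N) ℝ)}) ?_) ?_)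
      · refine iSup₂_le fun q hq => ?_
        rw [Finset.mem_singleton.1 hq]
      · have h := finrank_span_finset_le_card (R := ℝ)
          {(Matrix.vecMulVec (tA p.1) (fun a : Fin N => W a p.2) :
            Matrix (Fin D) (Fin N) ℝ)}
        rw [Finset.coe_singleton, Finset.card_singleton] at h
        exact h
    refine ⟨fun i => Finset.univ.filter (fun j => k (i, j) = 1), ?_, ?_⟩
    · intro i
      let T := Finset.univ.filter (fun j => k (i, j) = 1)
      have h2 := hk (T.map ⟨fun j => (i, j), fun a b h => by simpa using h⟩)
      rw [Finset.sum_map] at h2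
      have h3 : ∑ j ∈ T, k (i, j) = T.card := by
        rw [Finset.card_eq_sum_ones]
        exact Finset.sum_congr rfl fun j hj => (Finset.mem_filter.1 hj).2
      refine (h3.symm.le.trans h2).trans ?_
      let L : (Fin N → ℝ) →ₗ[ℝ] Matrix (Fin D) (Fin N) ℝ :=
        { toFun := fun w => Matrix.vecMulVec (tA i) w
          map_add' := fun x y => Matrix.vecMulVec_add _ _ _
          map_smul' := fun c x => Matrix.vecMulVec_smul _ _ _ }
      refine le_trans (Submodule.finrank_mono (t := LinearMap.range L) ?_)
        ((LinearMap.finrank_range_le L).trans (by simp))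
      refine iSup₂_le fun p hp => ?_
      rw [Submodule.span_singleton_le_iff_mem]
      obtain ⟨j, _, rfl⟩ := Finset.mem_map.1 hp
      exact ⟨fun a => W a j, rfl⟩
    · funext p
      have := h1 p
      by_cases h : k p = 1
      · simp [F, h]
      · simp [F, h]; omega
  · rintro ⟨f, hf, rfl⟩ S
    let T := S.filter (fun p => p.2 ∈ f p.1)
    have hs : ∑ p ∈ S, F f p = T.card := by
      simp [F, T, Finset.sum_ite]
    have hli := aux_li D Dstar N N' tA hrows W hNN hW f hf T
      (fun p hp => (Finset.mem_filter.1 hp).2)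
    rw [hs, ← Fintype.card_coe, ← finrank_span_eq_card hli]
    refine Submodule.finrank_mono ?_
    rw [Submodule.span_le]
    rintro _ ⟨p, rfl⟩
    have hp : p.1 ∈ S := (Finset.mem_filter.1 p.2).1
    exact (le_iSup₂_of_le (f := fun (p : Fin Dstar × Fin N') (_ : p ∈ S) =>
      Submodule.span ℝ {Matrix.vecMulVec (tA p.1) (fun a : Fin N => W a p.2)})
      p.1 hp le_rfl) (Submodule.mem_span_singleton_self _)
end

section
/- Let \hat{A} \in \mathbb{R}^{D\times D} be a matrix with D^* pairwise-distinct rows whose distinct rows are linearly independent. Then the set of parameters (W, b) \in \mathbb{R}^{N\times N'} \times \mathbb{R}^{N'} for which the number of linear regions of the one-layer GCN satisfies R_{\mathcal{N},(W,b)} \ne (\sum_{i=0}^{N} \binom{N'}{i})^{D^*} has Lebesgue measure zero in \mathbb{R}^{N\times N'} \times \mathbb{R}^{N'} \cong \mathbb{R}^{N N' + N'}. In particular, for Lebesgue-almost-every (W, b), R_{\mathcal{N},(W,b)} = (\sum_{i=0}^{N} \binom{N'}{i})^{D^*}. -/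
open MeasureTheory

namespace GCNaux

open Finset Matrix

/-- sets of positive coordinates that are realised -/
noncomputable def fam {N n : ℕ} (W : Matrix (Fin N) (Fin n) ℝ) (b : Fin n → ℝ) :
    Finset (Finset (Fin n)) := by
  classical
  exact Finset.univ.filter fun s => ∃ x : Fin N → ℝ, ∀ j,
    (j ∈ s → 0 < (x ᵥ* W) j + b j) ∧ (j ∉ s → (x ᵥ* W) j + b j < 0)

lemma mem_fam {N n : ℕ} (W : Matrix (Fin N) (Fin n) ℝ) (b : Fin n → ℝ) (s : Finset (Fin n)) :
    s ∈ fam W b ↔ ∃ x : Fin N → ℝ, ∀ j,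
    (j ∈ s → 0 < (x ᵥ* W) j + b j) ∧ (j ∉ s → (x ᵥ* W) j + b j < 0) := by
  classical
  simp [fam]

lemma card_small (N n : ℕ) : #{J : Finset (Fin n) | #J ≤ N} = ∑ i ∈ range (N + 1), n.choose i := by
  rw [Finset.card_eq_sum_card_fiberwise (f := Finset.card) (t := range (N + 1))]
  · refine Finset.sum_congr rfl fun i hi => ?_
    rw [show n.choose i = #(powersetCard i (univ : Finset (Fin n))) by simp]
    congr 1
    ext J
    simp only [mem_range, mem_filter, mem_univ, true_and, mem_powersetCard, subset_univ] at *
    omega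
  · intro J hJ
    simp at *
    omega

lemma shatters_card_le {N n : ℕ} (W : Matrix (Fin N) (Fin n) ℝ) (b : Fin n → ℝ)
    (J : Finset (Fin n)) (hJ : (fam W b).Shatters J) : #J ≤ N := by
  classical
  by_contra! hlt
  have hdep : ¬ LinearIndependent ℝ (fun j : J => fun i : Fin N => W i j) := by
    intro h
    have := h.fintype_card_le_finrank
    simp at this
    omega
  rw [Fintype.not_linearIndependent_iff] at hdep
  obtain ⟨c, hc, a, ha⟩ := hdep
  have key : ∀ x : Fin N → ℝ, ∑ j : J, c j * ((x ᵥ* W) j + b j) = ∑ j : J, c j * b j := by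
    intro x
    have h0 : ∑ j : J, c j * (x ᵥ* W) j = 0 := by
      have h1 := congrArg (fun v => x ⬝ᵥ v) hc
      simp only [dotProduct_zero] at h1
      rw [← h1, dotProduct_sum]
      refine Finset.sum_congr rfl fun j _ => ?_
      rw [dotProduct_smul]
      rfl
    simp only [mul_add, Finset.sum_add_distrib, h0, zero_add]
  -- contradiction from a sign pattern
  have pos : ∀ d : J → ℝ, d a ≠ 0 → (∀ x : Fin N → ℝ,
      ∑ j : J, d j * ((x ᵥ* W) j + b j) ≤ 0) → False := by
    intro d hd hle
    obtain ⟨u, hu, hut⟩ := hJ (t := J.filter fun j => ∃ h : j ∈ J, 0 < d ⟨j, h⟩)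
      (filter_subset _ _)
    obtain ⟨x, hx⟩ := (mem_fam W b u).1 hu
    have hiff : ∀ j : J, (j : Fin n) ∈ u ↔ 0 < d j := by
      intro j
      have := Finset.ext_iff.1 hut j
      simpa using this
    have hnn : ∀ j : J, 0 ≤ d j * ((x ᵥ* W) j + b j) := by
      intro j
      by_cases h : 0 < d j
      · exact mul_nonneg h.le ((hx j).1 ((hiff j).2 h)).le
      · exact mul_nonneg_of_nonpos_of_nonpos (not_lt.1 h)
          ((hx j).2 (fun h' => h ((hiff j).1 h'))).le
    have hp : 0 < d a * ((x ᵥ* W) a + b a) := by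
      refine lt_of_le_of_ne (hnn a) (Ne.symm (mul_ne_zero hd ?_))
      by_cases h : (a : Fin n) ∈ u
      · exact ((hx a).1 h).ne'
      · exact ((hx a).2 h).ne
    have : 0 < ∑ j : J, d j * ((x ᵥ* W) j + b j) :=
      Finset.sum_pos' (fun j _ => hnn j) ⟨a, mem_univ _, hp⟩
    linarith [hle x]
  rcases le_total (∑ j : J, c j * b j) 0 with h | h
  · exact pos c ha fun x => by rw [key]; exact h
  · refine pos (fun j => - c j) (by simpa using ha) fun x => ?_
    simp only [neg_mul, Finset.sum_neg_distrib]
    rw [key]; linarith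

lemma card_le_of_strong {n : ℕ} (F S : Finset (Finset (Fin n)))
    (h : ∀ J ∈ S, ∃ g : Finset (Fin n), ∀ t ⊆ J, t ∪ (g \ J) ∈ F) : #S ≤ #F := by
  classical
  have h1 := card_le_card_shatterer (Fᶜ)
  have h2 : #(Fᶜ.shatterer) ≤ #(Sᶜ) := by
    refine Finset.card_le_card_of_injOn (fun J => Jᶜ) ?_ (fun a _ b _ h => compl_injective h)
    intro J hJ
    simp only [coe_compl, Set.mem_compl_iff, mem_coe, mem_shatterer] at *
    intro hS
    obtain ⟨g, hg⟩ := h _ hS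
    obtain ⟨u, hu, hut⟩ := hJ (t := g \ Jᶜ) (by intro x; simp)
    rw [mem_compl] at hu
    apply hu
    have := hg (u \ J) (by intro x; simp)
    rw [← hut] at this
    convert this using 1
    ext x
    simp
    tauto
  rw [card_compl] at h1 h2
  have := card_le_univ F
  have := card_le_univ S
  omega

/-- the extended matrix -/
def ext {N n : ℕ} (p : (Fin N → Fin n → ℝ) × (Fin n → ℝ)) : Matrix (Option (Fin N)) (Fin n) ℝ :=
  fun i j => i.elim (p.2 j) (fun i => p.1 i j)

lemma ae_det {N n : ℕ} {ι : Type*} [Fintype ι] [DecidableEq ι] (r : ι → Option (Fin N))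
    (c : ι → Fin n) (hr : Function.Injective r) (hc : Function.Injective c) :
    ∀ᵐ p : (Fin N → Fin n → ℝ) × (Fin n → ℝ), ((ext p).submatrix r c).det ≠ 0 := by
  classical
  let V0 : Option (Fin N) → Fin n → ℝ := fun i j => if ∃ a, r a = i ∧ c a = j then 1 else 0
  let v : (Fin N → Fin n → ℝ) × (Fin n → ℝ) := (fun i j => V0 (some i) j, fun j => V0 none j)
  let L : ℝ →ₗ[ℝ] (Fin N → Fin n → ℝ) × (Fin n → ℝ) := LinearMap.toSpanSingleton ℝ _ v
  have hcont : Continuous fun p : (Fin N → Fin n → ℝ) × (Fin n → ℝ) =>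
      ((ext p).submatrix r c).det := by
    apply Continuous.matrix_det
    refine continuous_pi fun a => continuous_pi fun a' => ?_
    simp only [Matrix.submatrix_apply, ext]
    cases r a <;> simp <;> fun_prop
  have hms : MeasurableSet {p : (Fin N → Fin n → ℝ) × (Fin n → ℝ) |
      ((ext p).submatrix r c).det ≠ 0} :=
    (isOpen_ne_fun hcont continuous_const).measurableSet
  have hI1 : (volume : Measure (Fin N → Fin n → ℝ)).IsAddHaarMeasure := by
    exact Measure.pi.isAddHaarMeasure (fun _ : Fin N => (volume : Measure (Fin n → ℝ)))
  have hI2 : (volume : Measure ((Fin N → Fin n → ℝ) × (Fin n → ℝ))).IsAddHaarMeasure := by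
    exact Measure.prod.instIsAddHaarMeasure _ _
  refine ae_mem_of_ae_add_linearMap_mem L volume volume hms fun y => ?_
  have hEq : ∀ t : ℝ, ((ext (y + L t)).submatrix r c).det
      = (-((ext y).submatrix r c)).charpoly.eval t := by
    intro t
    rw [Matrix.eval_charpoly]
    congr 1
    ext a a'
    have hV : V0 (r a) (c a') = if a = a' then 1 else 0 := by
      simp only [V0]
      congr 1
      apply propext
      constructor
      · rintro ⟨k, h1, h2⟩
        rw [← hr h1, hc h2]
      · rintro rfl
        exact ⟨a, rfl, rfl⟩
    have : ext (y + L t) (r a) (c a') = ext y (r a) (c a') + t * V0 (r a) (c a') := by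
      simp only [ext, L, v]
      cases r a <;> simp
    rw [Matrix.submatrix_apply, this, hV]
    by_cases h : a = a'
    · subst h; simp [Matrix.scalar_apply]; ring
    · simp [Matrix.scalar_apply, h]
  have hfin : {t : ℝ | ¬ (y + L t) ∈ {p : (Fin N → Fin n → ℝ) × (Fin n → ℝ) |
      ((ext p).submatrix r c).det ≠ 0}}.Finite := by
    refine (Polynomial.rootSet_finite (-((ext y).submatrix r c)).charpoly ℝ).subset ?_
    intro t ht
    simp only [Set.mem_ofPred_eq, not_not] at ht
    rw [hEq] at ht
    rw [Polynomial.mem_rootSet]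
    exact ⟨(Matrix.charpoly_monic _).ne_zero, by simpa using ht⟩
  exact hfin.measure_zero _

/-- genericity -/
def Gen {N n : ℕ} (p : (Fin N → Fin n → ℝ) × (Fin n → ℝ)) : Prop :=
  ∀ (J : Finset (Fin n)) (e : J → Fin N), Function.Injective e →
    ((ext p).submatrix (fun a : J => some (e a)) (fun a : J => (a : Fin n))).det ≠ 0 ∧
    ∀ k, k ∉ J → ((ext p).submatrix (fun a : Option J => a.map e)
      (fun a : Option J => a.elim k (fun a => (a : Fin n)))).det ≠ 0

lemma ae_gen (N n : ℕ) : ∀ᵐ p : (Fin N → Fin n → ℝ) × (Fin n → ℝ), Gen p := by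
  unfold Gen
  refine ae_all_iff.2 fun J => ae_all_iff.2 fun e => ae_all_iff.2 fun he => ?_
  refine Filter.Eventually.and ?_ (ae_all_iff.2 fun k => ae_all_iff.2 fun hk => ?_)
  · exact ae_det _ _ (fun a b h => he (Option.some_injective _ h)) Subtype.val_injective
  · refine ae_det _ _ (Option.map_injective he) ?_
    rintro (_ | a) (_ | a') h
    · rfl
    · exact absurd a'.2 (by simp only [Option.elim] at h; rw [← h]; exact hk)
    · exact absurd a.2 (by simp only [Option.elim] at h; rw [h]; exact hk)
    · simp only [Option.elim] at h
      rw [Subtype.ext h]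

lemma strong_of_gen {N n : ℕ} (p : (Fin N → Fin n → ℝ) × (Fin n → ℝ)) (hp : Gen p)
    (J : Finset (Fin n)) (hJ : #J ≤ N) :
    ∃ g : Finset (Fin n), ∀ t ⊆ J, t ∪ (g \ J) ∈ fam (Matrix.of p.1) p.2 := by
  classical
  obtain ⟨e⟩ : Nonempty (J ↪ Fin N) := by
    apply Function.Embedding.nonempty_of_card_le
    simpa using hJ
  obtain ⟨h1, h2⟩ := hp J e e.injective
  set M := (ext p).submatrix (fun a : J => some (e a)) (fun a : J => (a : Fin n)) with hM
  have hsum : ∀ (z : J → ℝ) (j : Fin n),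
      ((fun i => ∑ a, if e a = i then z a else 0) ᵥ* (Matrix.of p.1)) j
        = ∑ a, z a * p.1 (e a) j := by
    intro z j
    simp only [Matrix.vecMul, dotProduct, Finset.sum_mul, Matrix.of_apply]
    rw [Finset.sum_comm]
    refine Finset.sum_congr rfl fun a _ => ?_
    simp [ite_mul]
  have hsurj : ∀ y : J → ℝ, ∃ z : J → ℝ, ∀ j : J, ∑ a, z a * p.1 (e a) j = y j := by
    intro y
    obtain ⟨z, hz⟩ := Matrix.vecMul_surjective_iff_isUnit.2
      ((Matrix.isUnit_iff_isUnit_det M).2 (isUnit_iff_ne_zero.2 h1)) y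
    exact ⟨z, fun j => congrFun hz j⟩
  obtain ⟨z0, hz0⟩ := hsurj (fun j => - p.2 j)
  set x0 : Fin N → ℝ := fun i => ∑ a, if e a = i then z0 a else 0 with hx0
  have hk0 : ∀ k, k ∉ J → (x0 ᵥ* (Matrix.of p.1)) k + p.2 k ≠ 0 := by
    intro k hk h0
    rw [hsum] at h0
    apply h2 k hk
    rw [← Matrix.exists_vecMul_eq_zero_iff]
    refine ⟨fun a => a.elim 1 z0, fun h => by simpa using congrFun h none, ?_⟩
    funext a
    simp only [Matrix.vecMul, dotProduct, Fintype.sum_option, Matrix.submatrix_apply, ext,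
      Option.map, Option.elim, one_mul, Pi.zero_apply]
    cases a with
    | none => simpa [add_comm] using h0
    | some j =>
      have := hz0 j
      simp only
      linarith
  refine ⟨univ.filter fun k => 0 < (x0 ᵥ* (Matrix.of p.1)) k + p.2 k, fun t ht => ?_⟩
  obtain ⟨z, hz⟩ := hsurj (fun j => if (j : Fin n) ∈ t then 1 else -1)
  set u : Fin N → ℝ := fun i => ∑ a, if e a = i then z a else 0 with hu
  have hexp : ∀ (ε : ℝ) j, ((x0 + ε • u) ᵥ* (Matrix.of p.1)) j + p.2 j
      = ((x0 ᵥ* (Matrix.of p.1)) j + p.2 j) + ε * (u ᵥ* (Matrix.of p.1)) j := by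
    intro ε j
    rw [Matrix.add_vecMul, Matrix.smul_vecMul]
    simp; ring
  have hev : ∀ᶠ ε : ℝ in nhdsWithin 0 (Set.Ioi 0), 0 < ε ∧ ∀ k, k ∉ J →
      0 < ((x0 ᵥ* (Matrix.of p.1)) k + p.2 k) *
        (((x0 ᵥ* (Matrix.of p.1)) k + p.2 k) + ε * (u ᵥ* (Matrix.of p.1)) k) := by
    refine Filter.Eventually.and self_mem_nhdsWithin ?_
    refine Filter.eventually_all.2 fun k => Filter.eventually_all.2 fun hk => ?_
    refine Filter.Eventually.filter_mono nhdsWithin_le_nhds ?_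
    have hc : Continuous fun ε : ℝ => ((x0 ᵥ* (Matrix.of p.1)) k + p.2 k) *
        (((x0 ᵥ* (Matrix.of p.1)) k + p.2 k) + ε * (u ᵥ* (Matrix.of p.1)) k) := by fun_prop
    apply hc.continuousAt.eventually (lt_mem_nhds _)
    simpa using mul_self_pos.2 (hk0 k hk)
  obtain ⟨ε, hε, hεk⟩ := hev.exists
  rw [mem_fam]
  refine ⟨x0 + ε • u, fun j => ?_⟩
  rw [hexp]
  by_cases hj : j ∈ J
  · have e1 : (x0 ᵥ* (Matrix.of p.1)) j + p.2 j = 0 := by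
      rw [hsum, hz0 ⟨j, hj⟩]; simp
    have e2 : (u ᵥ* (Matrix.of p.1)) j = if j ∈ t then 1 else -1 := by
      rw [hsum, hz ⟨j, hj⟩]
    rw [e1, e2]
    by_cases hjt : j ∈ t <;> simp [hjt, hj, hε]
  · have hjt : j ∉ t := fun h => hj (ht h)
    have := hεk j hj
    simp only [mem_union, hjt, mem_sdiff, mem_filter, mem_univ, true_and, hj, not_false_eq_true,
      and_true, false_or]
    constructor
    · intro h; exact (pos_iff_pos_of_mul_pos this).1 h
    · intro h; by_contra h'
      rcases lt_or_gt_of_ne (hk0 j hj) with h3 | h3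
      · nlinarith
      · exact h h3

lemma card_fam {N n : ℕ} (p : (Fin N → Fin n → ℝ) × (Fin n → ℝ)) (hp : Gen p) :
    #(fam (Matrix.of p.1) p.2) = ∑ i ∈ range (N + 1), n.choose i := by
  rw [← card_small]
  apply le_antisymm
  · refine (card_le_card_shatterer _).trans (card_le_card fun J hJ => ?_)
    simpa using shatters_card_le _ _ J (mem_shatterer.1 hJ)
  · refine card_le_of_strong _ _ fun J hJ => strong_of_gen p hp J (by simpa using hJ)

lemma regions_eq (D N n : ℕ) (A : Matrix (Fin D) (Fin D) ℝ)
    (hindep : LinearIndependent ℝ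
      (fun r : {x // x ∈ Finset.univ.image (fun d : Fin D => A d)} => (r : Fin D → ℝ)))
    (W : Matrix (Fin N) (Fin n) ℝ) (b : Fin n → ℝ) :
    oneLayerGCNRegions D N n A W b =
      #(fam W b) ^ (Finset.univ.image (fun d : Fin D => A d)).card := by
  classical
  let R := {x // x ∈ Finset.univ.image (fun d : Fin D => A d)}
  let row : Fin D → R := fun d => ⟨A d, Finset.mem_image_of_mem _ (Finset.mem_univ d)⟩
  have hrow : Function.Surjective row := by
    rintro ⟨x, hx⟩
    obtain ⟨d, -, rfl⟩ := Finset.mem_image.1 hx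
    exact ⟨d, rfl⟩
  have hent : ∀ (X : Matrix (Fin D) (Fin N) ℝ) i j, (A * X * W) i j = ((A i ᵥ* X) ᵥ* W) j := by
    intro X i j
    rfl
  let Φ : (R → {s // s ∈ fam W b}) → (Fin D → Fin n → ℝ) :=
    fun g i j => if j ∈ (g (row i)).1 then 1 else -1
  have hΦ : Function.Injective Φ := by
    intro g g' h
    funext r
    obtain ⟨i, rfl⟩ := hrow r
    apply Subtype.ext
    ext j
    have := congrFun (congrFun h i) j
    simp only [Φ] at this
    split_ifs at this <;> first | (norm_num at this; done) | simp [*]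
  have hset : {P : Fin D → Fin n → ℝ |
    (∀ i j, P i j = 1 ∨ P i j = -1) ∧
    ∃ X : Matrix (Fin D) (Fin N) ℝ, ∀ i j, P i j * ((A * X * W) i j + b j) > 0}
      = Φ '' Set.univ := by
    ext P
    simp only [Set.mem_ofPred_eq, Set.image_univ, Set.mem_range]
    constructor
    · rintro ⟨hP, X, hX⟩
      have hne : ∀ r : R, ∀ j, ((r.1 ᵥ* X) ᵥ* W) j + b j ≠ 0 := by
        intro r j h0
        obtain ⟨i, rfl⟩ := hrow r
        have := hX i j
        rw [hent] at this
        simp only [row] at h0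
        rw [h0] at this
        simp at this
      refine ⟨fun r => ⟨univ.filter fun j => 0 < ((r.1 ᵥ* X) ᵥ* W) j + b j, ?_⟩, ?_⟩
      · rw [mem_fam]
        refine ⟨r.1 ᵥ* X, fun j => ⟨fun h => by simpa using h, fun h => ?_⟩⟩
        exact lt_of_le_of_ne (by simpa using h) (hne r j)
      · funext i j
        have := hX i j
        rw [hent] at this
        simp only [Φ, mem_filter, mem_univ, true_and, row]
        rcases hP i j with h | h
        · rw [h] at this ⊢
          rw [if_pos (by linarith)]
        · rw [h] at this ⊢
          rw [if_neg (by linarith)]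
    · rintro ⟨g, rfl⟩
      refine ⟨fun i j => by simp only [Φ]; split_ifs <;> simp, ?_⟩
      choose x hx using fun r : R => (mem_fam W b _).1 (g r).2
      obtain ⟨L, hL⟩ := LinearMap.exists_extend
        ((Module.Basis.span hindep).constr ℝ x)
      have hLr : ∀ r : R, L r.1 = x r := by
        intro r
        have h1 := (Module.Basis.span hindep).constr_basis ℝ x r
        rw [← hL] at h1
        rw [← h1]
        simp [Module.Basis.span_apply]
      refine ⟨(LinearMap.toMatrix' L)ᵀ, fun i j => ?_⟩
      rw [hent, Matrix.vecMul_transpose, LinearMap.toMatrix'_mulVec]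
      have h2 := hLr (row i)
      simp only [row] at h2
      rw [h2]
      have h3 := hx (row i) j
      simp only [Φ]
      split_ifs with h
      · have := h3.1 h
        simpa [row] using this
      · have := h3.2 h
        simp only [row] at this
        simp only [gt_iff_lt]
        linarith
  have hfin : Finite R := Finite.of_surjective row hrow
  unfold oneLayerGCNRegions
  rw [hset, Set.ncard_image_of_injective _ hΦ, Set.ncard_univ, Nat.card_fun]
  simp only [R, Nat.card_eq_fintype_card, Fintype.card_coe]

end GCNaux

/-- if the distinct rows of `Â` are linearly independent and there are
`D*` of them, then for Lebesgue-almost every parameter `(W, b)` the number of linear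
regions of the one-layer GCN equals `(∑_{i=0}^{N} (N' choose i))^{D*}`: the set of
parameters where this fails has Lebesgue measure zero. -/
theorem generic_parameters_num_regions
    (D Dstar N N' : ℕ)
    (Ahat : Matrix (Fin D) (Fin D) ℝ)
    (hDstar : (Finset.univ.image (fun d : Fin D => Ahat d)).card = Dstar)
    (hindep : LinearIndependent ℝ
      (fun r : {x // x ∈ Finset.univ.image (fun d : Fin D => Ahat d)} => (r : Fin D → ℝ))) :
    volume {p : (Fin N → Fin N' → ℝ) × (Fin N' → ℝ) |
        oneLayerGCNRegions D N N' Ahat (Matrix.of p.1) p.2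
          ≠ (∑ i ∈ Finset.range (N + 1), N'.choose i) ^ Dstar} = 0 := by
  refine measure_mono_null ?_ (ae_iff.1 (GCNaux.ae_gen N N'))
  intro p hp hG
  apply hp
  rw [GCNaux.regions_eq D N N' Ahat hindep, GCNaux.card_fam p hG, hDstar]
end

section
/- Let \hat{A} \in \mathbb{R}^{D\times D} be a matrix with D^* pairwise-distinct rows whose distinct rows are linearly independent, and let \mu be a probability measure on the parameter space \mathbb{R}^{N\times N'} \times \mathbb{R}^{N'} that is absolutely continuous with respect to Lebesgue measure. Then the expectation of the number of linear regions of the one-layer GCN satisfies E_{(W,b)\sim\mu}[R_{\mathcal{N},(W,b)}] = (\sum_{i=0}^{N} \binom{N'}{i})^{D^*}. -/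
open MeasureTheory

lemma ae_ne_zero_of_analytic {E : Type*} [NormedAddCommGroup E] [NormedSpace ℝ E]
    [FiniteDimensional ℝ E] [MeasurableSpace E] [BorelSpace E] (μ : Measure E) [μ.IsAddHaarMeasure]
    [SFinite μ]
    (f : E → ℝ) (hf : ∀ x, AnalyticAt ℝ f x) (x0 : E) (h0 : f x0 ≠ 0) : ∀ᵐ x ∂μ, f x ≠ 0 := by
  have hc : Continuous f := continuous_iff_continuousAt.2 fun x => (hf x).continuousAt
  have : ProperSpace E := FiniteDimensional.proper_real E
  have : SecondCountableTopology E := inferInstance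
  let g : E × ℝ → ℝ := fun q => f (q.2 • (q.1 - x0) + x0)
  have hg : Continuous g := by fun_prop
  have hm : MeasurableSet {q : E × ℝ | g q ≠ 0} :=
    (isOpen_ne_fun hg continuous_const).measurableSet
  have h1 : ∀ᵐ q ∂(μ.prod (volume : Measure ℝ)), g q ≠ 0 := by
    rw [Measure.ae_prod_iff_ae_ae hm]
    refine Filter.Eventually.of_forall fun x => ?_
    have ha : AnalyticOnNhd ℝ (fun t : ℝ => g (x, t)) Set.univ := by
      intro t _
      have h2 : AnalyticAt ℝ (fun t : ℝ => t • (x - x0) + x0) t := by fun_prop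
      exact AnalyticAt.fun_comp (g := f) (hf _) h2
    rcases ha.eqOn_zero_or_eventually_ne_zero_of_preconnected isPreconnected_univ with h | h
    · exact absurd (h (Set.mem_univ (0:ℝ))) (by simpa [g] using h0)
    · have := ae_restrict_le_codiscreteWithin (μ := (volume : Measure ℝ)) MeasurableSet.univ h
      rw [Measure.restrict_univ] at this
      exact this
  have h2 : ∀ᵐ q ∂((volume : Measure ℝ).prod μ), g q.swap ≠ 0 := by
    rw [← Measure.prod_swap] at h1
    exact (ae_map_iff measurable_swap.aemeasurable hm).1 h1
  have h3 := Measure.ae_ae_of_ae_prod h2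
  have h4 : ∀ᵐ t : ℝ, t ≠ 0 := by simp [ae_iff]
  obtain ⟨t, ht, ht0⟩ := (h3.and h4).exists
  rw [ae_iff] at ht ⊢
  have h5 := Measure.addHaar_image_homothety μ x0 t {a : E | ¬ g (Prod.swap (t, a)) ≠ 0}
  rw [ht, mul_zero] at h5
  refine measure_mono_null ?_ h5
  intro x hx
  refine ⟨t⁻¹ • (x - x0) + x0, ?_, ?_⟩
  · simpa [g, smul_smul, ht0] using hx
  · simp [AffineMap.homothety_apply, smul_smul, ht0]

lemma analyticAt_det {E ι : Type*} [NormedAddCommGroup E] [NormedSpace ℝ E] [Fintype ι]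
    [DecidableEq ι] (M : E → Matrix ι ι ℝ) (x : E) (h : ∀ i j, AnalyticAt ℝ (fun e => M e i j) x) :
    AnalyticAt ℝ (fun e => (M e).det) x := by
  simp only [Matrix.det_apply', ]
  refine Finset.analyticAt_fun_sum _ fun σ _ => ?_
  exact analyticAt_const.mul (Finset.analyticAt_fun_prod _ fun i _ => h _ _)

lemma gen_ae (N N' : ℕ) (S : Finset (Fin N')) (hS : S.card ≤ N) :
    ∀ᵐ p : (Fin N → Fin N' → ℝ) × (Fin N' → ℝ),
      ∃ y : Fin N → ℝ, (∀ k ∉ S, ∑ i, y i * p.1 i k + p.2 k ≠ 0) ∧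
        (∀ j ∈ S, ∑ i, y i * p.1 i j + p.2 j = 0) ∧
        ∀ σ : Fin N' → ℝ, ∃ v : Fin N → ℝ, ∀ j ∈ S, ∑ i, v i * p.1 i j = σ j := by
  classical
  obtain ⟨e⟩ : Nonempty (S ↪ Fin N) := by
    apply Function.Embedding.nonempty_of_card_le
    simpa using hS
  let M : (Fin N → Fin N' → ℝ) × (Fin N' → ℝ) → Matrix S S ℝ := fun p =>
    Matrix.of fun j j' => p.1 (e j') j
  let W0 : Fin N → Fin N' → ℝ := fun i j => if ∃ h : j ∈ S, e ⟨j, h⟩ = i then 1 else 0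
  have hM0 : ∀ b, M (W0, b) = 1 := by
    intro b
    ext j j'
    simp [M, W0, Matrix.one_apply]
  have hW0 : ∀ i, ∀ k ∉ S, W0 i k = 0 := by
    intro i k hk
    simp [W0, hk]
  have hWa : ∀ (x : (Fin N → Fin N' → ℝ) × (Fin N' → ℝ)) i j,
      AnalyticAt ℝ (fun p : (Fin N → Fin N' → ℝ) × (Fin N' → ℝ) => p.1 i j) x := fun x i j =>
    ((ContinuousLinearMap.proj (R := ℝ) (φ := fun _ : Fin N' => ℝ) j).comp
      ((ContinuousLinearMap.proj (R := ℝ) (φ := fun _ : Fin N => Fin N' → ℝ) i).comp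
        (ContinuousLinearMap.fst ℝ (Fin N → Fin N' → ℝ) (Fin N' → ℝ)))).analyticAt x
  have hba : ∀ (x : (Fin N → Fin N' → ℝ) × (Fin N' → ℝ)) j,
      AnalyticAt ℝ (fun p : (Fin N → Fin N' → ℝ) × (Fin N' → ℝ) => p.2 j) x := fun x j =>
    ((ContinuousLinearMap.proj (R := ℝ) (φ := fun _ : Fin N' => ℝ) j).comp
        (ContinuousLinearMap.snd ℝ (Fin N → Fin N' → ℝ) (Fin N' → ℝ))).analyticAt x
  have hH1 : (volume : Measure (Fin N → Fin N' → ℝ)).IsAddHaarMeasure :=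
    Measure.pi.isAddHaarMeasure (fun _ : Fin N => (volume : Measure (Fin N' → ℝ)))
  have hH : (volume : Measure ((Fin N → Fin N' → ℝ) × (Fin N' → ℝ))).IsAddHaarMeasure :=
    Measure.prod.instIsAddHaarMeasure _ _
  have hMa : ∀ x i j, AnalyticAt ℝ (fun p => M p i j) x := by
    intro x i j
    simp only [M, Matrix.of_apply]
    exact hWa x _ _
  have h1 : ∀ᵐ p : (Fin N → Fin N' → ℝ) × (Fin N' → ℝ), (M p).det ≠ 0 :=
    ae_ne_zero_of_analytic _ _ (fun x => analyticAt_det M x (hMa x)) (W0, 0) (by simp [hM0])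
  have h2 : ∀ᵐ p : (Fin N → Fin N' → ℝ) × (Fin N' → ℝ), ∀ k : {k // k ∉ S},
      (M p).det * p.2 k - ∑ j, (M p).cramer (fun j => p.2 j) j * p.1 (e j) k ≠ 0 := by
    rw [ae_all_iff]
    intro k
    refine ae_ne_zero_of_analytic _ _ (fun x => ?_) (W0, Pi.single k 1) ?_
    · refine AnalyticAt.sub ((analyticAt_det M x (hMa x)).mul (hba x _)) ?_
      refine Finset.analyticAt_fun_sum _ fun j _ => ?_
      refine AnalyticAt.mul ?_ (hWa x _ _)
      simp only [Matrix.cramer_apply]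
      refine analyticAt_det _ x fun a c => ?_
      simp only [Matrix.updateCol_apply]
      split_ifs
      · exact hba x _
      · exact hMa x _ _
    · simp [hM0, hW0 _ _ k.2]
  filter_upwards [h1, h2] with p hp1 hp2
  have key : ∀ (z : S → ℝ) (k : Fin N'),
      ∑ i, (∑ j, if e j = i then z j else 0) * p.1 i k = ∑ j, z j * p.1 (e j) k := by
    intro z k
    simp only [Finset.sum_mul, ite_mul, zero_mul]
    rw [Finset.sum_comm]
    simp
  have solve : ∀ (c : S → ℝ), ∀ j (hj : j ∈ S),
      ∑ j', ((M p).det⁻¹ * (M p).cramer c j') * p.1 (e j') j = c ⟨j, hj⟩ := by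
    intro c j hj
    have := congrFun (Matrix.mulVec_cramer (M p) c) ⟨j, hj⟩
    simp only [Matrix.mulVec, dotProduct, M, Matrix.of_apply, Pi.smul_apply, smul_eq_mul] at this
    simp only [mul_assoc]
    rw [← Finset.mul_sum]
    rw [inv_mul_eq_iff_eq_mul₀ hp1, ← this]
    exact Finset.sum_congr rfl fun _ _ => mul_comm _ _
  refine ⟨fun i => ∑ j, if e j = i then -((M p).det⁻¹ * (M p).cramer (fun j => p.2 j) j) else 0,
    ?_, ?_, ?_⟩
  · intro k hk h
    rw [key] at h
    apply hp2 ⟨k, hk⟩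
    simp only [neg_mul, Finset.sum_neg_distrib, mul_assoc, ← Finset.mul_sum] at h
    field_simp at h
    linarith
  · intro j hj
    rw [key]
    simp only [neg_mul, Finset.sum_neg_distrib]
    rw [solve _ j hj]; simp
  · intro σ
    refine ⟨fun i => ∑ j, if e j = i then ((M p).det⁻¹ * (M p).cramer (fun j => σ j) j) else 0, ?_⟩
    intro j hj
    rw [key, solve _ j hj]

lemma card_le_of_strong {n : ℕ} (A B : Finset (Finset (Fin n)))
    (h : ∀ S ∈ B, ∃ U : Finset (Fin n), ∀ T, (∀ k ∉ S, k ∈ T ↔ k ∈ U) → T ∈ A) :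
    B.card ≤ A.card := by
  classical
  have h1 := Finset.card_le_card_shatterer (Aᶜ)
  have h2 : B.image compl ⊆ (Aᶜ.shatterer)ᶜ := by
    intro S hS
    obtain ⟨S, hSB, rfl⟩ := Finset.mem_image.1 hS
    obtain ⟨U, hU⟩ := h S hSB
    simp only [Finset.mem_compl, Finset.mem_shatterer]
    intro hsh
    obtain ⟨V, hV, hVU⟩ := hsh (t := Sᶜ ∩ U) Finset.inter_subset_left
    apply Finset.mem_compl.1 hV
    apply hU
    intro k hk
    have := congrArg (k ∈ ·) hVU
    simpa [hk] using this
  have h3 := Finset.card_le_card h2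
  rw [Finset.card_image_of_injective _ compl_injective] at h3
  rw [Finset.card_compl] at h1 h3
  have h4 := Finset.card_le_univ A
  have h5 := Finset.card_le_univ (Aᶜ.shatterer)
  omega

lemma card_small (n N : ℕ) : (Finset.univ.filter fun S : Finset (Fin n) => S.card ≤ N).card
    = ∑ i ∈ Finset.range (N + 1), n.choose i := by
  classical
  have : (Finset.univ.filter fun S : Finset (Fin n) => S.card ≤ N)
      = (Finset.range (N+1)).biUnion fun i => Finset.powersetCard i Finset.univ := by
    ext S; simp [Finset.mem_powersetCard]
  rw [this, Finset.card_biUnion]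
  · simp
  · intro i _ j _ hij
    exact Finset.pairwise_disjoint_powersetCard _ hij

open Classical in
/-- realizable positive sets -/
noncomputable def posSets (N N' : ℕ) (W : Fin N → Fin N' → ℝ) (b : Fin N' → ℝ) :
    Finset (Finset (Fin N')) :=
  Finset.univ.filter fun T => ∃ y : Fin N → ℝ, ∀ j,
    0 < (if j ∈ T then (1:ℝ) else -1) * (∑ i, y i * W i j + b j)

lemma card_posSets_le (N N' : ℕ) (W : Fin N → Fin N' → ℝ) (b : Fin N' → ℝ) :
    (posSets N N' W b).card ≤ ∑ i ∈ Finset.range (N + 1), N'.choose i := by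
  classical
  rw [← card_small]
  refine (Finset.card_le_card_shatterer _).trans (Finset.card_le_card ?_)
  intro S hS
  rw [Finset.mem_shatterer] at hS
  simp only [Finset.mem_filter, Finset.mem_univ, true_and]
  by_contra! hcard
  obtain ⟨c, hc, j0, hj0⟩ : ∃ c : S → ℝ, ∑ j, c j • (fun i => W i j : Fin N → ℝ) = 0 ∧
      ∃ j, c j ≠ 0 := by
    by_contra! hh
    have := (Fintype.linearIndependent_iff.2 hh).fintype_card_le_finrank
    simp at this
    omega
  have main : ∀ c : S → ℝ, ∑ j, c j • (fun i => W i j : Fin N → ℝ) = 0 → (∃ j, c j ≠ 0) →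
      0 < ∑ j, c j * b j := by
    intro c hc ⟨j0, hj0⟩
    obtain ⟨u, hu, hus⟩ := hS (t := S.filter fun j => ∃ h : j ∈ S, 0 < c ⟨j, h⟩)
      (Finset.filter_subset _ _)
    simp only [posSets, Finset.mem_filter, Finset.mem_univ, true_and] at hu
    obtain ⟨y, hy⟩ := hu
    have hmem : ∀ j : S, (j : Fin N') ∈ u ↔ 0 < c j := by
      intro j
      have := congrArg ((j : Fin N') ∈ ·) hus
      simpa using this
    have hsum : ∑ j : S, c j * (∑ i, y i * W i j + b j) = ∑ j, c j * b j := by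
      simp only [mul_add, Finset.sum_add_distrib, Finset.mul_sum]
      rw [Finset.sum_comm]
      have : ∀ i, ∑ j : S, c j * (y i * W i j) = 0 := by
        intro i
        have := congrFun hc i
        simp only [Finset.sum_apply, Pi.smul_apply, smul_eq_mul, Pi.zero_apply] at this
        rw [← mul_zero (y i), ← this, Finset.mul_sum]
        exact Finset.sum_congr rfl fun _ _ => by ring
      rw [Finset.sum_congr rfl fun i _ => this i]
      simp
    rw [← hsum]
    have hpos : ∀ j : S, c j ≠ 0 → 0 < c j * (∑ i, y i * W i j + b j) := by
      intro j hj
      have h1 := hy j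
      rcases lt_or_gt_of_ne hj with h | h
      · rw [if_neg (by rw [hmem]; exact not_lt.2 h.le)] at h1
        exact mul_pos_of_neg_of_neg h (by linarith)
      · rw [if_pos ((hmem j).2 h)] at h1
        exact mul_pos h (by linarith)
    refine Finset.sum_pos' (fun j _ => ?_) ⟨j0, Finset.mem_univ _, hpos j0 hj0⟩
    by_cases h : c j = 0
    · simp [h]
    · exact (hpos j h).le
  have p1 := main c hc ⟨j0, hj0⟩
  have p2 := main (-c) (by simpa using hc) ⟨j0, by simpa using hj0⟩
  simp only [Pi.neg_apply, neg_mul, Finset.sum_neg_distrib] at p2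
  linarith

lemma le_card_posSets (N N' : ℕ) (W : Fin N → Fin N' → ℝ) (b : Fin N' → ℝ)
    (h : ∀ S : Finset (Fin N'), S.card ≤ N →
      ∃ y : Fin N → ℝ, (∀ k ∉ S, ∑ i, y i * W i k + b k ≠ 0) ∧
        (∀ j ∈ S, ∑ i, y i * W i j + b j = 0) ∧
        ∀ σ : Fin N' → ℝ, ∃ v : Fin N → ℝ, ∀ j ∈ S, ∑ i, v i * W i j = σ j) :
    ∑ i ∈ Finset.range (N + 1), N'.choose i ≤ (posSets N N' W b).card := by
  classical
  rw [← card_small]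
  apply card_le_of_strong
  intro S hS
  obtain ⟨y, hy1, hy2, hy3⟩ := h S (by simpa using hS)
  refine ⟨Finset.univ.filter fun k => 0 < ∑ i, y i * W i k + b k, fun T hT => ?_⟩
  obtain ⟨v, hv⟩ := hy3 (fun j => if j ∈ T then 1 else -1)
  simp only [posSets, Finset.mem_filter, Finset.mem_univ, true_and] at hT ⊢
  have hlin : ∀ ε j, ∑ i, (y i + ε * v i) * W i j + b j
      = (∑ i, y i * W i j + b j) + ε * ∑ i, v i * W i j := by
    intro ε j
    simp only [add_mul, Finset.sum_add_distrib, Finset.mul_sum, mul_assoc]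
    ring
  have hev : ∀ᶠ ε : ℝ in nhdsWithin 0 (Set.Ioi 0), ∀ j,
      0 < (if j ∈ T then (1:ℝ) else -1) * (∑ i, (y i + ε * v i) * W i j + b j) := by
    rw [Filter.eventually_all]
    intro j
    simp only [hlin]
    by_cases hj : j ∈ S
    · filter_upwards [self_mem_nhdsWithin] with ε hε
      rw [hy2 j hj, hv j hj]
      have : (0:ℝ) < ε := hε
      split_ifs <;> simpa using this
    · have hc : Continuous fun ε : ℝ => (if j ∈ T then (1:ℝ) else -1) *
          ((∑ i, y i * W i j + b j) + ε * ∑ i, v i * W i j) := by fun_prop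
      apply Filter.Eventually.filter_mono nhdsWithin_le_nhds
      apply hc.continuousAt.eventually (lt_mem_nhds _)
      have h1 := hT j hj
      have h2 := hy1 j hj
      split_ifs with hjT
      · simpa using h1.1 hjT
      · have : ¬ 0 < ∑ i, y i * W i j + b j := fun h => hjT (h1.2 h)
        have := lt_of_le_of_ne (not_lt.1 this) h2
        simp only [zero_mul, add_zero]
        linarith
  obtain ⟨ε, hε⟩ := hev.exists
  exact ⟨_, hε⟩

lemma regions_eq (D Dstar N N' : ℕ)
    (Ahat : Matrix (Fin D) (Fin D) ℝ)
    (hDstar : (Finset.univ.image (fun d : Fin D => Ahat d)).card = Dstar)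
    (hindep : LinearIndependent ℝ
      (fun r : {x // x ∈ Finset.univ.image (fun d : Fin D => Ahat d)} => (r : Fin D → ℝ)))
    (W : Fin N → Fin N' → ℝ) (b : Fin N' → ℝ) :
    oneLayerGCNRegions D N N' Ahat (Matrix.of W) b = (posSets N N' W b).card ^ Dstar := by
  classical
  let R := {x // x ∈ Finset.univ.image (fun d : Fin D => Ahat d)}
  letI : Fintype R := Finset.fintypeCoeSort _
  let row : Fin D → R := fun d => ⟨Ahat d, Finset.mem_image_of_mem _ (Finset.mem_univ d)⟩
  have hrow : Function.Surjective row := by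
    rintro ⟨x, hx⟩
    obtain ⟨d, _, rfl⟩ := Finset.mem_image.1 hx
    exact ⟨d, rfl⟩
  let F : (R → posSets N N' W b) → (Fin D → Fin N' → ℝ) := fun g d j =>
    if j ∈ (g (row d)).1 then 1 else -1
  have hF : Function.Injective F := by
    intro g g' h
    funext r
    obtain ⟨d, rfl⟩ := hrow r
    apply Subtype.ext
    ext j
    have := congrFun (congrFun h d) j
    simp only [F] at this
    split_ifs at this with h1 h2 h2
    · simp [h1, h2]
    · norm_num at this
    · norm_num at this
    · simp [h1, h2]
  have hmul : ∀ (X : Matrix (Fin D) (Fin N) ℝ) d j, (Ahat * X * Matrix.of W) d j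
      = ∑ i, (Ahat * X) d i * W i j := by
    intro X d j
    simp [Matrix.mul_apply (M := Ahat * X)]
  have hset : {P : Fin D → Fin N' → ℝ |
    (∀ i j, P i j = 1 ∨ P i j = -1) ∧
    ∃ X : Matrix (Fin D) (Fin N) ℝ, ∀ i j, P i j * ((Ahat * X * Matrix.of W) i j + b j) > 0}
      = Set.range F := by
    ext P
    constructor
    · rintro ⟨hP, X, hX⟩
      have hPeq : ∀ d d', Ahat d = Ahat d' → P d = P d' := by
        intro d d' h
        funext j
        have h1 := hX d j
        have h2 := hX d' j
        have h3 : (Ahat * X * Matrix.of W) d j = (Ahat * X * Matrix.of W) d' j := by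
          rw [hmul, hmul]
          simp only [Matrix.mul_apply, h]
        rw [h3] at h1
        rcases hP d j with h4 | h4 <;> rcases hP d' j with h5 | h5 <;> rw [h4] at h1 <;>
          rw [h5] at h2 <;> rw [h4, h5] <;> linarith
      choose s hs using hrow
      refine ⟨fun r => ⟨Finset.univ.filter fun j => P (s r) j = 1, ?_⟩, ?_⟩
      · simp only [posSets, Finset.mem_filter, Finset.mem_univ, true_and]
        refine ⟨fun i => (Ahat * X) (s r) i, fun j => ?_⟩
        have h1 := hX (s r) j
        rw [hmul] at h1
        rcases hP (s r) j with h | h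
        · rw [if_pos h]; rwa [h] at h1
        · rw [if_neg (by rw [h]; norm_num)]; rwa [h] at h1
      · funext d j
        have h1 : P (s (row d)) = P d := hPeq _ _ (congrArg Subtype.val (hs (row d)))
        simp only [F, Finset.mem_filter, Finset.mem_univ, true_and, h1]
        rcases hP d j with h | h
        · rw [if_pos h, h]
        · rw [if_neg (by rw [h]; norm_num), h]
    · rintro ⟨g, rfl⟩
      refine ⟨fun d j => ?_, ?_⟩
      · simp only [F]; split_ifs <;> simp
      · have hg : ∀ r, ∃ y : Fin N → ℝ, ∀ j,
            0 < (if j ∈ (g r).1 then (1:ℝ) else -1) * (∑ i, y i * W i j + b j) := by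
          intro r
          have := (g r).2
          simpa only [posSets, Finset.mem_filter, Finset.mem_univ, true_and] using this
        choose y hy using hg
        obtain ⟨L, hL⟩ : ∃ L : (Fin D → ℝ) →ₗ[ℝ] (Fin N → ℝ), ∀ r : R, L r.1 = y r := by
          obtain ⟨L, hL⟩ := LinearMap.exists_extend ((Module.Basis.span hindep).constr ℝ y)
          refine ⟨L, fun r => ?_⟩
          have h1 := LinearMap.congr_fun hL (Module.Basis.span hindep r)
          rw [Module.Basis.constr_basis] at h1
          rw [← h1, LinearMap.comp_apply, Submodule.subtype_apply, Module.Basis.span_apply]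
        refine ⟨Matrix.of fun d => L (Pi.single d 1), fun d j => ?_⟩
        rw [hmul]
        have h2 : ∀ i, (Ahat * Matrix.of fun d => L (Pi.single d 1)) d i = y (row d) i := by
          intro i
          rw [← hL (row d), LinearMap.pi_apply_eq_sum_univ L (row d).1]
          simp only [Matrix.mul_apply, Matrix.of_apply, Finset.sum_apply, Pi.smul_apply,
            smul_eq_mul, row]
          refine Finset.sum_congr rfl fun k _ => ?_
          have : (Pi.single k 1 : Fin D → ℝ) = fun j => if k = j then 1 else 0 := by
            funext l
            simp [Pi.single_apply, eq_comm]
          rw [this]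
        simp only [h2]
        exact hy (row d) j
  unfold oneLayerGCNRegions
  rw [hset, ← Set.image_univ, Set.ncard_image_of_injective _ hF, Set.ncard_univ,
    Nat.card_eq_fintype_card, Fintype.card_fun, Fintype.card_coe]
  congr 1
  rw [← hDstar]
  exact Fintype.card_coe _

/-- if the distinct rows of `Â` are linearly independent, there are `D*`
of them, and the parameters `(W, b)` are drawn from a probability measure `μ` that is
absolutely continuous with respect to Lebesgue measure, then the expected number of
linear regions of the one-layer GCN equals `(∑_{i=0}^{N} (N' choose i))^{D*}`. -/
theorem expected_num_regions
    (D Dstar N N' : ℕ)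
    (Ahat : Matrix (Fin D) (Fin D) ℝ)
    (hDstar : (Finset.univ.image (fun d : Fin D => Ahat d)).card = Dstar)
    (hindep : LinearIndependent ℝ
      (fun r : {x // x ∈ Finset.univ.image (fun d : Fin D => Ahat d)} => (r : Fin D → ℝ)))
    (μ : Measure ((Fin N → Fin N' → ℝ) × (Fin N' → ℝ)))
    [IsProbabilityMeasure μ] (hac : μ ≪ volume) :
    ∫ p, (oneLayerGCNRegions D N N' Ahat (Matrix.of p.1) p.2 : ℝ) ∂μ
      = ((∑ i ∈ Finset.range (N + 1), N'.choose i) ^ Dstar : ℕ) := by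
  have h1 : ∀ᵐ p ∂μ, (oneLayerGCNRegions D N N' Ahat (Matrix.of p.1) p.2 : ℝ)
      = ((∑ i ∈ Finset.range (N + 1), N'.choose i) ^ Dstar : ℕ) := by
    have h2 : ∀ᵐ p : (Fin N → Fin N' → ℝ) × (Fin N' → ℝ), ∀ S : Finset (Fin N'), S.card ≤ N →
        ∃ y : Fin N → ℝ, (∀ k ∉ S, ∑ i, y i * p.1 i k + p.2 k ≠ 0) ∧
        (∀ j ∈ S, ∑ i, y i * p.1 i j + p.2 j = 0) ∧
        ∀ σ : Fin N' → ℝ, ∃ v : Fin N → ℝ, ∀ j ∈ S, ∑ i, v i * p.1 i j = σ j := by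
      rw [ae_all_iff]
      intro S
      by_cases hS : S.card ≤ N
      · filter_upwards [gen_ae N N' S hS] with p hp _ using hp
      · exact Filter.Eventually.of_forall fun p h => absurd h hS
    filter_upwards [hac.ae_le h2] with p hp
    rw [regions_eq D Dstar N N' Ahat hDstar hindep,
      le_antisymm (card_posSets_le N N' p.1 p.2) (le_card_posSets N N' p.1 p.2 hp)]
  rw [integral_congr_ae h1]
  simp
end

section
/- Let \hat{A} \in \mathbb{R}^{D\times D} be a matrix with D^* pairwise-distinct rows whose distinct rows are linearly independent, and fix N \ge 1. For each positive integer N', let R_{\mathcal{N}}(N') denote the maximum, over all parameters (W, b) \in \mathbb{R}^{N\times N'} \times \mathbb{R}^{N'}, of the number of linear regions of the one-layer GCN with adjacency \hat{A}, input dimension D\times N and output dimension D\times N'. Then R_{\mathcal{N}}(N') = \Theta((N')^{D^* N}) as N' \to \infty: there exist constants c_1, c_2 > 0 and M such that for all N' \ge M, c_1 (N')^{D^* N} \le R_{\mathcal{N}}(N') \le c_2 (N')^{D^* N}. -/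
/-- The maximal number of linear regions of the one-layer GCN with adjacency `Ahat`,
over all parameters `(W, b)`. -/
noncomputable def maxOneLayerGCNRegions (D Nin Nout : ℕ)
    (Ahat : Matrix (Fin D) (Fin D) ℝ) : ℕ :=
  sSup {r : ℕ | ∃ (W : Matrix (Fin Nin) (Fin Nout) ℝ) (b : Fin Nout → ℝ),
    r = oneLayerGCNRegions D Nin Nout Ahat W b}

open Classical in
noncomputable def gcnPat {N n : ℕ} (W : Matrix (Fin N) (Fin n) ℝ) (b : Fin n → ℝ) :
    Finset (Finset (Fin n)) :=
  Finset.univ.filter (fun s => ∃ y : Fin N → ℝ, ∀ j,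
    (j ∈ s → 0 < ∑ i, y i * W i j + b j) ∧ (j ∉ s → ∑ i, y i * W i j + b j < 0))

lemma gcn_key {N n : ℕ} (W : Matrix (Fin N) (Fin n) ℝ) (b : Fin n → ℝ) (s : Finset (Fin n))
    (hs : (gcnPat W b).Shatters s) (g : s → ℝ)
    (hg : ∑ j : s, g j • (fun i => W i j : Fin N → ℝ) = 0) (hne : ∃ j, g j ≠ 0) :
    0 < ∑ j : s, g j * b j := by
  classical
  obtain ⟨u, hu, hsu⟩ := hs (t := s.filter (fun j => ∃ h : j ∈ s, 0 < g ⟨j, h⟩))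
    (Finset.filter_subset _ _)
  simp only [gcnPat, Finset.mem_filter, Finset.mem_univ, true_and] at hu
  obtain ⟨y, hy⟩ := hu
  have hmem : ∀ j : s, (j : Fin n) ∈ u ↔ 0 < g j := by
    intro j
    have := Finset.ext_iff.1 hsu j
    simpa using this
  have h1 : ∑ j : s, g j * b j = ∑ j : s, g j * (∑ i, y i * W i j + b j) := by
    have h0 : ∑ j : s, g j * (∑ i, y i * W i j) = 0 := by
      have h2 : ∀ i, ∑ j : s, g j * W i j = 0 := fun i => by
        have := congrFun hg i
        simpa using this
      calc ∑ j : s, g j * (∑ i, y i * W i j) = ∑ i, y i * ∑ j : s, g j * W i j := by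
            simp only [Finset.mul_sum]
            rw [Finset.sum_comm]
            refine Finset.sum_congr rfl fun i _ => Finset.sum_congr rfl fun j _ => by ring
        _ = 0 := by simp only [h2, mul_zero, Finset.sum_const_zero]
    simp only [mul_add, Finset.sum_add_distrib, h0, zero_add]
  rw [h1]
  have hpos : ∀ j : s, g j ≠ 0 → 0 < g j * (∑ i, y i * W i j + b j) := by
    intro j hj
    rcases lt_or_gt_of_ne hj with h | h
    · exact mul_pos_of_neg_of_neg h ((hy j).2 (by rw [hmem]; exact h.le.not_gt))
    · exact mul_pos h ((hy j).1 ((hmem j).2 h))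
  obtain ⟨j, hj⟩ := hne
  refine Finset.sum_pos' (fun i _ => ?_) ⟨j, Finset.mem_univ _, hpos j hj⟩
  by_cases h : g i = 0
  · simp [h]
  · exact (hpos i h).le

lemma gcn_vc {N n : ℕ} (W : Matrix (Fin N) (Fin n) ℝ) (b : Fin n → ℝ) :
    (gcnPat W b).vcDim ≤ N := by
  classical
  unfold Finset.vcDim
  refine Finset.sup_le fun s hs => ?_
  rw [Finset.mem_shatterer] at hs
  by_contra hcon
  have hli : ¬ LinearIndependent ℝ (fun j : s => (fun i => W i j : Fin N → ℝ)) := by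
    intro h
    have := h.fintype_card_le_finrank
    simp at this
    exact hcon this
  obtain ⟨g, hg, hne⟩ := Fintype.not_linearIndependent_iff.1 hli
  have h1 := gcn_key W b s hs g hg hne
  have h2 := gcn_key W b s hs (-g) (by simpa using hg) (by simpa using hne)
  simp only [Pi.neg_apply, neg_mul, Finset.sum_neg_distrib] at h2
  linarith

lemma gcn_card {N n : ℕ} (hn : 1 ≤ n) (W : Matrix (Fin N) (Fin n) ℝ) (b : Fin n → ℝ) :
    (gcnPat W b).card ≤ (N + 1) * n ^ N := by
  classical
  calc (gcnPat W b).card ≤ (gcnPat W b).shatterer.card := Finset.card_le_card_shatterer _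
    _ ≤ ∑ k ∈ Finset.Iic (gcnPat W b).vcDim, (Fintype.card (Fin n)).choose k :=
        Finset.card_shatterer_le_sum_vcDim
    _ ≤ ∑ k ∈ Finset.Iic N, n.choose k := by
        rw [Fintype.card_fin]
        exact Finset.sum_le_sum_of_subset (Finset.Iic_subset_Iic.2 (gcn_vc W b))
    _ ≤ ∑ k ∈ Finset.Iic N, n ^ N := by
        refine Finset.sum_le_sum fun k hk => ?_
        exact (Nat.choose_le_pow n k).trans (Nat.pow_le_pow_right hn (Finset.mem_Iic.1 hk))
    _ = _ := by simp

lemma gcn_upper {D N n : ℕ} (hn : 1 ≤ n) (A : Matrix (Fin D) (Fin D) ℝ)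
    (W : Matrix (Fin N) (Fin n) ℝ) (b : Fin n → ℝ) :
    oneLayerGCNRegions D N n A W b ≤
      ((N + 1) * n ^ N) ^ (Finset.univ.image (fun d : Fin D => A d)).card := by
  classical
  set R := Finset.univ.image (fun d : Fin D => A d) with hR
  have hrep : ∀ r : R, ∃ d, A d = r := by
    intro r
    have := r.2
    simp only [hR, Finset.mem_image, Finset.mem_univ, true_and] at this
    exact this
  choose rep hrep using hrep
  have hmemR : ∀ d, A d ∈ R := fun d => Finset.mem_image.2 ⟨d, Finset.mem_univ d, rfl⟩
  let F : (Fin D → Fin n → ℝ) → (R → Finset (Fin n)) :=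
    fun P r => Finset.univ.filter (fun j => P (rep r) j = 1)
  have hle : oneLayerGCNRegions D N n A W b ≤
      (Fintype.piFinset (fun _ : R => gcnPat W b)).card := by
    unfold oneLayerGCNRegions
    rw [← Set.ncard_coe_finset]
    refine Set.ncard_le_ncard_of_injOn F ?_ ?_ (Finset.finite_toSet _)
    · rintro P ⟨hP, X, hX⟩
      simp only [Finset.mem_coe, Fintype.mem_piFinset, gcnPat, Finset.mem_filter,
        Finset.mem_univ, true_and, F]
      intro r
      refine ⟨(A * X) (rep r), fun j => ⟨fun h => ?_, fun h => ?_⟩⟩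
      · have := hX (rep r) j
        rw [h, Matrix.mul_apply] at this
        linarith
      · have := hX (rep r) j
        rw [(hP _ j).resolve_left h, Matrix.mul_apply] at this
        linarith
    · rintro P ⟨hP, X, hX⟩ Q ⟨hQ, Y, hY⟩ hPQ
      have key : ∀ (P : Fin D → Fin n → ℝ), (∀ i j, P i j = 1 ∨ P i j = -1) →
          ∀ X : Matrix (Fin D) (Fin N) ℝ, (∀ i j, P i j * ((A * X * W) i j + b j) > 0) →
          ∀ d j, P d j = 1 ↔ P (rep ⟨A d, hmemR d⟩) j = 1 := by
        intro P hP X hX d j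
        have hA : (A * X * W) d j = (A * X * W) (rep ⟨A d, hmemR d⟩) j := by
          have := hrep ⟨A d, hmemR d⟩
          simp only [Matrix.mul_apply, this]
        have h1 := hX d j
        have h2 := hX (rep ⟨A d, hmemR d⟩) j
        rw [← hA] at h2
        rcases hP d j with h | h <;> rcases hP (rep ⟨A d, hmemR d⟩) j with h' | h' <;>
          rw [h] at h1 ⊢ <;> rw [h'] at h2 ⊢ <;> linarith
      funext d j
      have e : P d j = 1 ↔ Q d j = 1 := by
        rw [key P hP X hX d j, key Q hQ Y hY d j]
        have := Finset.ext_iff.1 (congrFun hPQ ⟨A d, hmemR d⟩) j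
        simpa [F] using this
      rcases hP d j with h | h
      · rw [h, e.1 h]
      · have : ¬ Q d j = 1 := fun h' => by
          have := e.2 h'
          rw [h] at this
          norm_num at this
        rw [h, (hQ d j).resolve_left this]
  refine hle.trans ?_
  rw [Fintype.card_piFinset]
  simp only [Finset.prod_const, Finset.card_univ, Fintype.card_coe]
  exact Nat.pow_le_pow_left (gcn_card hn W b) _

lemma gcn_solve {D : ℕ} {ι : Type*} (v : ι → Fin D → ℝ) (hv : LinearIndependent ℝ v) (t : ι → ℝ) :
    ∃ x : Fin D → ℝ, ∀ r, ∑ d, v r d * x d = t r := by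
  classical
  obtain ⟨L, hL⟩ := LinearMap.exists_leftInverse_of_injective (Finsupp.linearCombination ℝ v)
    (LinearMap.ker_eq_bot.2 hv)
  let φ := (Finsupp.linearCombination ℝ t) ∘ₗ L
  refine ⟨fun d => φ (Pi.single d 1), fun r => ?_⟩
  have h1 : φ (v r) = t r := by
    have := LinearMap.congr_fun hL (Finsupp.single r 1)
    simp at this
    simp [φ, this]
  rw [← h1]
  conv_rhs => rw [LinearMap.pi_apply_eq_sum_univ φ (v r)]
  refine Finset.sum_congr rfl fun d _ => ?_
  rw [smul_eq_mul]
  have : (Pi.single d 1 : Fin D → ℝ) = fun j => if d = j then 1 else 0 := by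
    funext j
    simp [Pi.single_apply, eq_comm]
  simp only [this]

lemma gcn_lower {D N n : ℕ} (hN : 1 ≤ N) (A : Matrix (Fin D) (Fin D) ℝ)
    (hindep : LinearIndependent ℝ
      (fun r : {x // x ∈ Finset.univ.image (fun d : Fin D => A d)} => (r : Fin D → ℝ))) :
    ∃ (W : Matrix (Fin N) (Fin n) ℝ) (b : Fin n → ℝ),
      (n / N) ^ ((Finset.univ.image (fun d : Fin D => A d)).card * N) ≤
      oneLayerGCNRegions D N n A W b := by
  classical
  set R := Finset.univ.image (fun d : Fin D => A d) with hR
  have hmemR : ∀ d, A d ∈ R := fun d => Finset.mem_image.2 ⟨d, Finset.mem_univ d, rfl⟩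
  refine ⟨fun i j => if (j : ℕ) % N = i then 1 else 0, fun j => -(((j : ℕ) / N : ℕ) : ℝ), ?_⟩
  set W : Matrix (Fin N) (Fin n) ℝ := fun i j => if (j : ℕ) % N = i then 1 else 0 with hW
  let m : Fin n → Fin N := fun j => ⟨(j : ℕ) % N, Nat.mod_lt _ hN⟩
  let G : (R → Fin N → Fin (n / N)) → (Fin D → Fin n → ℝ) := fun k d j =>
    if (j : ℕ) / N ≤ k ⟨A d, hmemR d⟩ (m j) then 1 else -1
  have hfin : {P : Fin D → Fin n → ℝ | (∀ i j, P i j = 1 ∨ P i j = -1) ∧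
      ∃ X : Matrix (Fin D) (Fin N) ℝ, ∀ i j,
        P i j * ((A * X * W) i j + -(((j : ℕ) / N : ℕ) : ℝ)) > 0}.Finite := by
    refine Set.Finite.subset (Set.Finite.pi' (fun _ : Fin D => Set.Finite.pi' 
      (fun _ : Fin n => (Set.toFinite ({1, -1} : Set ℝ))))) ?_
    rintro P ⟨hP, -⟩ i j
    simpa using hP i j
  have hcard : (Set.univ : Set (R → Fin N → Fin (n / N))).ncard = (n / N) ^ (R.card * N) := by
    rw [Set.ncard_univ, Nat.card_eq_fintype_card]
    simp [pow_mul, mul_comm]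
  rw [← hcard]
  unfold oneLayerGCNRegions
  refine Set.ncard_le_ncard_of_injOn G ?_ ?_ hfin
  · intro k _
    refine ⟨fun i j => ?_, ?_⟩
    · simp only [G]; split_ifs <;> simp
    · choose x hx using fun i : Fin N =>
        gcn_solve _ hindep (fun r => ((k r i : ℕ) : ℝ) + 1 / 2)
      let X : Matrix (Fin D) (Fin N) ℝ := fun d i => x i d
      refine ⟨X, fun d j => ?_⟩
      have h1 : ∀ i, (A * X) d i =
          ((k ⟨A d, hmemR d⟩ i : ℕ) : ℝ) + 1 / 2 := by
        intro i
        rw [Matrix.mul_apply]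
        exact hx i ⟨A d, hmemR d⟩
      have h2 : (A * X * W) d j =
          ((k ⟨A d, hmemR d⟩ (m j) : ℕ) : ℝ) + 1 / 2 := by
        rw [Matrix.mul_apply, Finset.sum_eq_single (m j)]
        · rw [h1]; simp [hW, m]
        · intro i _ hi
          have : ¬ (j : ℕ) % N = i := fun h => hi (Fin.ext h.symm)
          simp [hW, this]
        · simp
      rw [h2]
      simp only [G]
      split_ifs with h
      · have : (((j : ℕ) / N : ℕ) : ℝ) ≤ ((k ⟨A d, hmemR d⟩ (m j) : ℕ) : ℝ) := by
          exact_mod_cast h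
        linarith
      · have : ((k ⟨A d, hmemR d⟩ (m j) : ℕ) : ℝ) + 1 ≤ (((j : ℕ) / N : ℕ) : ℝ) := by
          exact_mod_cast (not_le.1 h)
        linarith
  · intro k _ l _ hkl
    have key : ∀ d i (t : ℕ), t < n / N →
        (t ≤ k ⟨A d, hmemR d⟩ i ↔ t ≤ l ⟨A d, hmemR d⟩ i) := by
      intro d i t ht
      have hlt : N * t + i < n := by
        have h1 : N * (n / N) ≤ n := Nat.mul_div_le n N
        have h2 : N * (t + 1) ≤ N * (n / N) := Nat.mul_le_mul_left _ ht
        have := i.2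
        rw [mul_add] at h2
        omega
      have h := congrFun (congrFun hkl d) ⟨N * t + i, hlt⟩
      have e1 : (N * t + i) / N = t := by
        rw [Nat.mul_add_div hN, Nat.div_eq_of_lt i.2, add_zero]
      have e2 : m ⟨N * t + i, hlt⟩ = i := by
        apply Fin.ext
        simp [m, Nat.mul_add_mod, Nat.mod_eq_of_lt i.2]
      simp only [G, e1, e2] at h
      split_ifs at h with h1 h2 h2
      · exact ⟨fun _ => h2, fun _ => h1⟩
      · norm_num at h
      · norm_num at h
      · exact ⟨fun h' => absurd h' h1, fun h' => absurd h' h2⟩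
    funext r i
    obtain ⟨r, hr⟩ := r
    obtain ⟨d, -, rfl⟩ := Finset.mem_image.1 hr
    apply Fin.ext
    exact le_antisymm ((key d i _ (k _ i).2).1 le_rfl) ((key d i _ (l _ i).2).2 le_rfl)

/-- if the distinct rows of `Â` are linearly independent, there are `D*`
of them, and `N ≥ 1` is fixed, then the maximal number of linear regions `R(N')` of the
one-layer GCN with input dimension `D×N` and output dimension `D×N'` satisfies
`R(N') = Θ((N')^{D* N})` as `N' → ∞`. -/
theorem one_layer_gcn_asymptotics
    (D Dstar N : ℕ) (hN : 1 ≤ N)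
    (Ahat : Matrix (Fin D) (Fin D) ℝ)
    (hDstar : (Finset.univ.image (fun d : Fin D => Ahat d)).card = Dstar)
    (hindep : LinearIndependent ℝ
      (fun r : {x // x ∈ Finset.univ.image (fun d : Fin D => Ahat d)} => (r : Fin D → ℝ))) :
    ∃ c₁ c₂ : ℝ, 0 < c₁ ∧ 0 < c₂ ∧ ∃ M : ℕ, ∀ N' : ℕ, M ≤ N' →
      c₁ * (N' : ℝ) ^ (Dstar * N) ≤ (maxOneLayerGCNRegions D N N' Ahat : ℝ) ∧
      (maxOneLayerGCNRegions D N N' Ahat : ℝ) ≤ c₂ * (N' : ℝ) ^ (Dstar * N) := by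
  have hNpos : (0 : ℝ) < N := by exact_mod_cast hN
  refine ⟨(1 / (2 * N : ℝ)) ^ (Dstar * N), ((N : ℝ) + 1) ^ Dstar, by positivity, by positivity,
    N, fun n hn => ?_⟩
  have hn1 : 1 ≤ n := hN.trans hn
  have hub : ∀ r ∈ {r : ℕ | ∃ (W : Matrix (Fin N) (Fin n) ℝ) (b : Fin n → ℝ),
      r = oneLayerGCNRegions D N n Ahat W b}, r ≤ ((N + 1) * n ^ N) ^ Dstar := by
    rintro r ⟨W, b, rfl⟩
    rw [← hDstar]
    exact gcn_upper hn1 Ahat W b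
  constructor
  · obtain ⟨W, b, hWb⟩ := gcn_lower (n := n) hN Ahat hindep
    rw [hDstar] at hWb
    have h1 : (n / N) ^ (Dstar * N) ≤ maxOneLayerGCNRegions D N n Ahat :=
      hWb.trans (le_csSup ⟨_, hub⟩ ⟨W, b, rfl⟩)
    have h2 : (((n / N : ℕ) : ℝ)) ^ (Dstar * N) ≤ (maxOneLayerGCNRegions D N n Ahat : ℝ) := by
      exact_mod_cast h1
    refine le_trans ?_ h2
    rw [← mul_pow]
    refine pow_le_pow_left₀ (by positivity) ?_ _
    have h3 : n ≤ 2 * N * (n / N) := by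
      have h4 : 1 ≤ n / N := Nat.div_pos hn hN
      have h5 := Nat.div_add_mod n N
      have h6 := Nat.mod_lt n hN
      nlinarith
    have h3' : (n : ℝ) ≤ 2 * N * ((n / N : ℕ) : ℝ) := by exact_mod_cast h3
    rw [one_div, inv_mul_le_iff₀ (by positivity)]
    exact h3'
  · have h1 : maxOneLayerGCNRegions D N n Ahat ≤ ((N + 1) * n ^ N) ^ Dstar :=
      csSup_le ⟨_, 0, 0, rfl⟩ hub
    have h2 : (maxOneLayerGCNRegions D N n Ahat : ℝ) ≤ (((N : ℝ) + 1) * n ^ N) ^ Dstar := by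
      exact_mod_cast h1
    rw [mul_pow, ← pow_mul, mul_comm N Dstar] at h2
    exact h2
end

section
/- Let \mathcal{N} be an L-layer ReLU GCN with adjacency \hat{A} \in \mathbb{R}^{D\times D}, input dimension D\times N_0 and layer output dimensions D\times N_l for l = 1,...,L, where N_l \ge N_0 for all l \ge 1. Let R_{\mathcal{N''}} denote the maximum, over all one-layer parameters, of the number of linear regions of the one-layer GCN with the same \hat{A}, input dimension D\times N_0 and output dimension D\times N_1. Then for every choice of parameters \theta of \mathcal{N}, the number of linear regions satisfies R_{\mathcal{N},\theta} \le R_{\mathcal{N''}} \cdot \prod_{l=2}^{L} \sum_{i=0}^{D N_0} \binom{D N_l}{i}. -/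
/-- Layer outputs of an `L`-layer ReLU GCN: `X 0 = X0` and
`X (l+1) = max(0, Ahat * X l * W l + 1 bᵀ)` entrywise. Here `Nd l` is the
feature dimension after `l` layers (`Nd 0` is the input feature dimension),
`W l` and `b l` are the weight and bias of layer `l + 1`. -/
noncomputable def gcnX (D : ℕ) (Ahat : Matrix (Fin D) (Fin D) ℝ) (Nd : ℕ → ℕ)
    (W : ∀ l : ℕ, Matrix (Fin (Nd l)) (Fin (Nd (l + 1))) ℝ)
    (b : ∀ l : ℕ, Fin (Nd (l + 1)) → ℝ)
    (X0 : Matrix (Fin D) (Fin (Nd 0)) ℝ) : (l : ℕ) → Matrix (Fin D) (Fin (Nd l)) ℝ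
  | 0 => X0
  | l + 1 => Matrix.of fun i j =>
      max 0 ((Ahat * gcnX D Ahat Nd W b X0 l * W l) i j + b l j)

/-- Preactivation of layer `l + 1` of the GCN:
`Z^{(l+1)}(X0) = Ahat * X^{(l)} * W l + 1 (b l)ᵀ`. -/
noncomputable def gcnZ (D : ℕ) (Ahat : Matrix (Fin D) (Fin D) ℝ) (Nd : ℕ → ℕ)
    (W : ∀ l : ℕ, Matrix (Fin (Nd l)) (Fin (Nd (l + 1))) ℝ)
    (b : ∀ l : ℕ, Fin (Nd (l + 1)) → ℝ)
    (X0 : Matrix (Fin D) (Fin (Nd 0)) ℝ) (l : ℕ) : Matrix (Fin D) (Fin (Nd (l + 1))) ℝ :=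
  Matrix.of fun i j => (Ahat * gcnX D Ahat Nd W b X0 l * W l) i j + b l j

/-- The number of linear regions of the `L`-layer ReLU GCN: the number of sign
patterns `P = (P^{(1)},…,P^{(L)})`, `P^{(l)} ∈ {±1}^{D×N_l}`, for which some
input `X0` satisfies `P^{(l)}_{ij} · Z^{(l)}(X0)_{ij} > 0` for all `l, i, j`. -/
noncomputable def gcnRegions (D L : ℕ) (Ahat : Matrix (Fin D) (Fin D) ℝ) (Nd : ℕ → ℕ)
    (W : ∀ l : ℕ, Matrix (Fin (Nd l)) (Fin (Nd (l + 1))) ℝ)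
    (b : ∀ l : ℕ, Fin (Nd (l + 1)) → ℝ) : ℕ :=
  Set.ncard {P : ∀ l : Fin L, Fin D → Fin (Nd ((l : ℕ) + 1)) → ℝ |
    (∀ l i j, P l i j = 1 ∨ P l i j = -1) ∧
    ∃ X0 : Matrix (Fin D) (Fin (Nd 0)) ℝ,
      ∀ (l : Fin L) (i : Fin D) (j : Fin (Nd ((l : ℕ) + 1))),
        P l i j * gcnZ D Ahat Nd W b X0 (l : ℕ) i j > 0}

theorem gcn_aux_affine {ι V : Type*} [Fintype ι] [DecidableEq ι] [AddCommGroup V] [Module ℝ V]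
    [FiniteDimensional ℝ V] (g : ι → V →ₗ[ℝ] ℝ) (c : ι → ℝ) :
    Set.ncard {S : Finset ι | ∃ x, ∀ i, i ∈ S ↔ 0 < g i x + c i} ≤
      ∑ k ∈ Finset.range (Module.finrank ℝ V + 1), (Fintype.card ι).choose k := by
  classical
  set A : Finset (Finset ι) :=
    Finset.univ.filter (fun S => ∃ x, ∀ i, i ∈ S ↔ 0 < g i x + c i) with hA
  have hset : {S : Finset ι | ∃ x, ∀ i, i ∈ S ↔ 0 < g i x + c i} = (A : Set (Finset ι)) := by
    ext S; simp [hA]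
  rw [hset, Set.ncard_coe_finset]
  have hvc : A.vcDim ≤ Module.finrank ℝ V := by
    unfold Finset.vcDim
    refine Finset.sup_le fun S hS => ?_
    rw [Finset.mem_shatterer] at hS
    by_contra! hlt
    have hdep : ¬ LinearIndependent ℝ (fun s : S => g s) := by
      intro hli
      have := hli.fintype_card_le_finrank
      rw [Subspace.dual_finrank_eq] at this
      simp at this
      omega
    rw [Fintype.not_linearIndependent_iff] at hdep
    obtain ⟨lam, hsum, i0, hi0⟩ := hdep
    have hconst : ∀ x, ∑ s : S, lam s * (g s x + c s) = ∑ s : S, lam s * c s := by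
      intro x
      have h0 := congrArg (fun f : V →ₗ[ℝ] ℝ => f x) hsum
      simp only [LinearMap.sum_apply, LinearMap.smul_apply, smul_eq_mul,
        LinearMap.zero_apply] at h0
      simp only [mul_add, Finset.sum_add_distrib, h0, zero_add]
    have key : ∀ p : S → Prop, ∃ x, ∀ s : S, p s ↔ 0 < g s x + c s := by
      intro p
      obtain ⟨u, hu, hSu⟩ := hS (t := (Finset.univ.filter p).map (Function.Embedding.subtype _)) (by
        intro i hi
        simp at hi
        exact hi.1)
      simp only [hA, Finset.mem_filter, Finset.mem_univ, true_and] at hu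
      obtain ⟨x, hx⟩ := hu
      refine ⟨x, fun s => ?_⟩
      rw [← hx]
      have := congrArg (fun T : Finset ι => (s : ι) ∈ T) hSu
      simpa using this.symm
    obtain ⟨x, hx⟩ := key (fun s => 0 < lam s)
    obtain ⟨y, hy⟩ := key (fun s => lam s < 0)
    have h1 : ∀ s, 0 ≤ lam s * (g s x + c s) := by
      intro s
      by_cases h : 0 < lam s
      · exact (mul_pos h ((hx s).1 h)).le
      · exact mul_nonneg_of_nonpos_of_nonpos (not_lt.1 h) (not_lt.1 (fun h' => h ((hx s).2 h')))
    have h2 : ∀ s, lam s * (g s y + c s) ≤ 0 := by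
      intro s
      by_cases h : lam s < 0
      · exact (mul_neg_of_neg_of_pos h ((hy s).1 h)).le
      · exact mul_nonpos_of_nonneg_of_nonpos (not_lt.1 h) (not_lt.1 (fun h' => h ((hy s).2 h')))
    have hX := hconst x
    have hY := hconst y
    rcases lt_or_gt_of_ne hi0 with h | h
    · have : ∑ s : S, lam s * (g s y + c s) < 0 :=
        Finset.sum_neg' (fun s _ => h2 s)
          ⟨i0, Finset.mem_univ _, mul_neg_of_neg_of_pos h ((hy i0).1 h)⟩
      have h3 := Finset.sum_nonneg (fun s (_ : s ∈ Finset.univ) => h1 s)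
      linarith
    · have : 0 < ∑ s : S, lam s * (g s x + c s) :=
        Finset.sum_pos' (fun s _ => h1 s)
          ⟨i0, Finset.mem_univ _, mul_pos h ((hx i0).1 h)⟩
      have h3 := Finset.sum_nonpos (fun s (_ : s ∈ Finset.univ) => h2 s)
      linarith
  calc A.card ≤ A.shatterer.card := Finset.card_le_card_shatterer A
    _ ≤ ∑ k ∈ Finset.Iic A.vcDim, (Fintype.card ι).choose k :=
        Finset.card_shatterer_le_sum_vcDim
    _ ≤ _ := by
        refine Finset.sum_le_sum_of_subset ?_
        intro k hk
        simp at hk ⊢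
        omega

theorem gcn_aux_lin (D L : ℕ)
    (Ahat : Matrix (Fin D) (Fin D) ℝ) (Nd : ℕ → ℕ)
    (W : ∀ l : ℕ, Matrix (Fin (Nd l)) (Fin (Nd (l + 1))) ℝ)
    (b : ∀ l : ℕ, Fin (Nd (l + 1)) → ℝ)
    (P : ∀ l : Fin L, Fin D → Fin (Nd ((l : ℕ) + 1)) → ℝ)
    (hP : ∀ l i j, P l i j = 1 ∨ P l i j = -1) :
    ∀ l : ℕ, l ≤ L → ∃ (g : Matrix (Fin D) (Fin (Nd 0)) ℝ →ₗ[ℝ] Matrix (Fin D) (Fin (Nd l)) ℝ)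
      (c : Matrix (Fin D) (Fin (Nd l)) ℝ), ∀ X0,
        (∀ (l : Fin L) (i : Fin D) (j : Fin (Nd ((l : ℕ) + 1))),
          P l i j * gcnZ D Ahat Nd W b X0 (l : ℕ) i j > 0) →
        gcnX D Ahat Nd W b X0 l = g X0 + c := by
  intro l
  induction l with
  | zero => intro _; exact ⟨LinearMap.id, 0, fun X0 _ => by simp [gcnX]⟩
  | succ l ih =>
    intro hl
    obtain ⟨g, c, h⟩ := ih (by omega)
    let l' : Fin L := ⟨l, hl⟩
    refine ⟨{ toFun := fun X => Matrix.of fun i j =>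
                if P l' i j = 1 then (Ahat * g X * W l) i j else 0
              map_add' := ?_
              map_smul' := ?_ },
      Matrix.of fun i j => if P l' i j = 1 then (Ahat * c * W l) i j + b l j else 0, ?_⟩
    · intro X Y
      ext i j
      simp only [Matrix.of_apply, Matrix.add_apply, map_add, Matrix.mul_add, Matrix.add_mul]
      split_ifs <;> simp
    · intro r X
      ext i j
      simp only [Matrix.of_apply, Matrix.smul_apply, map_smul, Matrix.mul_smul, Matrix.smul_mul]
      split_ifs <;> simp
    · intro X0 hX0
      ext i j
      have hs := hX0 l' i j
      have hz : gcnZ D Ahat Nd W b X0 l i j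
          = (Ahat * g X0 * W l) i j + ((Ahat * c * W l) i j + b l j) := by
        simp only [gcnZ, Matrix.of_apply, h X0 hX0, Matrix.mul_add, Matrix.add_mul,
          Matrix.add_apply]
        ring
      have hx : gcnX D Ahat Nd W b X0 (l+1) i j = max 0 (gcnZ D Ahat Nd W b X0 l i j) := rfl
      rw [hx]
      change P l' i j * gcnZ D Ahat Nd W b X0 l i j > 0 at hs
      simp only [LinearMap.coe_mk, AddHom.coe_mk, Matrix.add_apply, Matrix.of_apply]
      rcases hP l' i j with h1 | h1
      · rw [h1] at hs
        simp only [h1, if_true]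
        rw [max_eq_right (by linarith), hz]
      · rw [h1] at hs
        have : ¬ ((-1 : ℝ) = 1) := by norm_num
        simp only [h1, this, if_false]
        rw [max_eq_left (by linarith)]
        simp

theorem gcn_aux_finite (D L : ℕ) (Nd : ℕ → ℕ)
    (Q : (∀ l : Fin L, Fin D → Fin (Nd ((l : ℕ) + 1)) → ℝ) → Prop) :
    Set.Finite {P : ∀ l : Fin L, Fin D → Fin (Nd ((l : ℕ) + 1)) → ℝ |
      (∀ l i j, P l i j = 1 ∨ P l i j = -1) ∧ Q P} := by
  refine Set.Finite.subset (s := Set.pi Set.univ fun _ => Set.pi Set.univ fun _ =>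
    Set.pi Set.univ fun _ => ({1, -1} : Set ℝ)) ?_ ?_
  · exact Set.Finite.pi fun _ => Set.Finite.pi fun _ => Set.Finite.pi fun _ => Set.toFinite _
  · rintro P ⟨h, -⟩
    simpa [Set.mem_pi] using h

theorem gcn_aux_step (D L : ℕ)
    (Ahat : Matrix (Fin D) (Fin D) ℝ) (Nd : ℕ → ℕ)
    (W : ∀ l : ℕ, Matrix (Fin (Nd l)) (Fin (Nd (l + 1))) ℝ)
    (b : ∀ l : ℕ, Fin (Nd (l + 1)) → ℝ) :
    gcnRegions D (L + 1) Ahat Nd W b ≤ gcnRegions D L Ahat Nd W b *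
      ∑ i ∈ Finset.range (D * Nd 0 + 1), (D * Nd (L + 1)).choose i := by
  classical
  unfold gcnRegions
  have hf1 := gcn_aux_finite D (L+1) Nd (fun P => ∃ X0 : Matrix (Fin D) (Fin (Nd 0)) ℝ,
      ∀ (l : Fin (L+1)) (i : Fin D) (j : Fin (Nd ((l : ℕ) + 1))),
        P l i j * gcnZ D Ahat Nd W b X0 (l : ℕ) i j > 0)
  have hf2 := gcn_aux_finite D L Nd (fun P => ∃ X0 : Matrix (Fin D) (Fin (Nd 0)) ℝ,
      ∀ (l : Fin L) (i : Fin D) (j : Fin (Nd ((l : ℕ) + 1))),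
        P l i j * gcnZ D Ahat Nd W b X0 (l : ℕ) i j > 0)
  rw [Set.ncard_eq_toFinset_card _ hf1, Set.ncard_eq_toFinset_card _ hf2, mul_comm]
  refine Finset.card_le_mul_card_image_of_maps_to
    (f := fun P => fun l : Fin L => P l.castSucc) ?_ _ ?_
  · intro P hP
    rw [Set.Finite.mem_toFinset] at hP ⊢
    obtain ⟨h1, X0, h2⟩ := hP
    exact ⟨fun l => h1 l.castSucc, X0, fun l => h2 l.castSucc⟩
  · intro P0 hP0
    rw [Set.Finite.mem_toFinset] at hP0
    obtain ⟨hs, -⟩ := hP0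
    obtain ⟨g, c, hgc⟩ := gcn_aux_lin D L Ahat Nd W b P0 hs L le_rfl
    let G : Fin D × Fin (Nd (L+1)) → Matrix (Fin D) (Fin (Nd 0)) ℝ →ₗ[ℝ] ℝ := fun p =>
      { toFun := fun X => (Ahat * g X * W L) p.1 p.2
        map_add' := fun X Y => by simp [Matrix.mul_add, Matrix.add_mul]
        map_smul' := fun r X => by simp }
    let C : Fin D × Fin (Nd (L+1)) → ℝ := fun p => (Ahat * c * W L) p.1 p.2 + b L p.2
    have hb := gcn_aux_affine G C
    have hfr : Module.finrank ℝ (Matrix (Fin D) (Fin (Nd 0)) ℝ) = D * Nd 0 := by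
      simp [Module.finrank_matrix]
    rw [hfr, Fintype.card_prod, Fintype.card_fin, Fintype.card_fin] at hb
    refine le_trans ?_ hb
    rw [← Set.ncard_coe_finset]
    refine Set.ncard_le_ncard_of_injOn
      (fun P => Finset.univ.filter (fun p : Fin D × Fin (Nd (L+1)) => P (Fin.last L) p.1 p.2 = 1))
      ?_ ?_ (Set.toFinite _)
    · intro P hP
      rw [Finset.mem_coe, Finset.mem_filter, Set.Finite.mem_toFinset] at hP
      obtain ⟨⟨h1, X0, h2⟩, h3⟩ := hP
      refine ⟨X0, fun p => ?_⟩
      have hX := hgc X0 (by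
        intro l i j
        rw [← h3]
        exact h2 l.castSucc i j)
      have hz : gcnZ D Ahat Nd W b X0 L p.1 p.2 = G p X0 + C p := by
        simp only [gcnZ, Matrix.of_apply, hX, Matrix.mul_add, Matrix.add_mul,
          Matrix.add_apply, G, C, LinearMap.coe_mk, AddHom.coe_mk]
        ring
      rw [← hz]
      have h4 : P (Fin.last L) p.1 p.2 * gcnZ D Ahat Nd W b X0 L p.1 p.2 > 0 :=
        h2 (Fin.last L) p.1 p.2
      simp only [Finset.mem_filter, Finset.mem_univ, true_and]
      rcases h1 (Fin.last L) p.1 p.2 with h | h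
      · rw [h] at h4
        exact ⟨fun _ => by linarith, fun _ => h⟩
      · rw [h] at h4
        exact ⟨fun h' => by exfalso; have := h.symm.trans h'; norm_num at this,
          fun _ => by exfalso; linarith⟩
    · intro P hP Q hQ hPQ
      rw [Finset.mem_coe, Finset.mem_filter, Set.Finite.mem_toFinset] at hP hQ
      obtain ⟨⟨hP1, -⟩, hP3⟩ := hP
      obtain ⟨⟨hQ1, -⟩, hQ3⟩ := hQ
      funext l
      induction l using Fin.lastCases with
      | cast l => exact (congrFun hP3 l).trans (congrFun hQ3 l).symm
      | last =>
        funext i j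
        have h := Finset.ext_iff.1 hPQ (i, j)
        simp only [Finset.mem_filter, Finset.mem_univ, true_and] at h
        rcases hP1 (Fin.last L) i j with h1 | h1
        · exact h1.trans (h.1 h1).symm
        · rcases hQ1 (Fin.last L) i j with h2 | h2
          · exact (h.2 h2).trans h2.symm
          · exact h1.trans h2.symm

theorem gcn_aux_one_finite (D N : ℕ) (Q : (Fin D → Fin N → ℝ) → Prop) :
    {P : Fin D → Fin N → ℝ | (∀ i j, P i j = 1 ∨ P i j = -1) ∧ Q P} ⊆
      Set.pi Set.univ (fun _ => Set.pi Set.univ fun _ => ({1, -1} : Set ℝ)) ∧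
    (Set.pi Set.univ (fun _ : Fin D => Set.pi Set.univ fun _ : Fin N =>
      ({1, -1} : Set ℝ))).Finite := by
  constructor
  · rintro P ⟨h, -⟩
    simpa [Set.mem_pi] using h
  · exact Set.Finite.pi fun _ => Set.Finite.pi fun _ => Set.toFinite _

/-- upper bound for multi-layer GCNs. For an `L`-layer ReLU GCN with
`N_l ≥ N_0` for `1 ≤ l ≤ L` and any parameters, the number of linear regions is at most
`R_{N''} · ∏_{l=2}^{L} ∑_{i=0}^{D N_0} (D N_l choose i)`, where `R_{N''}` is the maximal
number of linear regions of the one-layer GCN with the same `Â`, input dimension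
`D × N_0` and output dimension `D × N_1`. -/
theorem multilayer_gcn_upper_bound
    (D L : ℕ) (hL : 1 ≤ L)
    (Ahat : Matrix (Fin D) (Fin D) ℝ) (Nd : ℕ → ℕ)
    (hNd : ∀ l, 1 ≤ l → l ≤ L → Nd 0 ≤ Nd l)
    (W : ∀ l : ℕ, Matrix (Fin (Nd l)) (Fin (Nd (l + 1))) ℝ)
    (b : ∀ l : ℕ, Fin (Nd (l + 1)) → ℝ) :
    gcnRegions D L Ahat Nd W b ≤
      sSup {r : ℕ | ∃ (W₁ : Matrix (Fin (Nd 0)) (Fin (Nd 1)) ℝ) (b₁ : Fin (Nd 1) → ℝ),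
          r = oneLayerGCNRegions D (Nd 0) (Nd 1) Ahat W₁ b₁} *
        ∏ l ∈ Finset.Icc 2 L, ∑ i ∈ Finset.range (D * Nd 0 + 1), (D * Nd l).choose i := by
  clear hNd
  induction L, hL using Nat.le_induction with
  | base =>
    simp only [Finset.Icc_eq_empty_of_lt (show (1:ℕ) < 2 by norm_num), Finset.prod_empty, mul_one]
    have hle : gcnRegions D 1 Ahat Nd W b ≤
        oneLayerGCNRegions D (Nd 0) (Nd 1) Ahat (W 0) (b 0) := by
      unfold gcnRegions oneLayerGCNRegions
      refine Set.ncard_le_ncard_of_injOn (fun P => P 0) ?_ ?_ ?_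
      · rintro P ⟨h1, X0, h2⟩
        exact ⟨h1 0, X0, h2 0⟩
      · intro P _ Q _ h
        funext l
        obtain rfl : l = 0 := Subsingleton.elim _ _
        exact h
      · obtain ⟨h1, h2⟩ := gcn_aux_one_finite D (Nd 1) (fun P =>
          ∃ X : Matrix (Fin D) (Fin (Nd 0)) ℝ, ∀ i j, P i j * ((Ahat * X * W 0) i j + b 0 j) > 0)
        exact h2.subset h1
    refine hle.trans (le_csSup ?_ ⟨W 0, b 0, rfl⟩)
    refine ⟨Set.ncard (Set.pi Set.univ (fun _ : Fin D => Set.pi Set.univ fun _ : Fin (Nd 1) =>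
      ({1, -1} : Set ℝ))), ?_⟩
    rintro r ⟨W₁, b₁, rfl⟩
    obtain ⟨h1, h2⟩ := gcn_aux_one_finite D (Nd 1) (fun P =>
      ∃ X : Matrix (Fin D) (Fin (Nd 0)) ℝ, ∀ i j, P i j * ((Ahat * X * W₁) i j + b₁ j) > 0)
    exact Set.ncard_le_ncard h1 h2
  | succ L hL ih =>
    rw [Finset.prod_Icc_succ_top (by omega), ← mul_assoc]
    exact (gcn_aux_step D L Ahat Nd W b).trans (Nat.mul_le_mul_right _ ih)
end

section
/- Let A \in \{0,1\}^{D\times D} be the symmetric adjacency matrix of a graph on D nodes, M the diagonal matrix with M_{ii} = \sum_j (I + A)_{ij}, and \hat{A} = M^{-1/2}(I + A)M^{-1/2}; assume \hat{A} is invertible. Fix L \ge 1 and N \ge 1, and for each positive integer N' let R_{\mathcal{N}}(N') denote the maximum, over all parameters, of the number of linear regions of the L-layer ReLU GCN with adjacency \hat{A}, input dimension D\times N and all layer output dimensions equal to D\times N'. Then there exist a constant c > 0 and M_0 such that for all N' \ge M_0, R_{\mathcal{N}}(N') \ge c\,(N')^{L\,N\,D}. In particular, the maximal number of linear regions of the deep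 GCN grows in N' at a rate exponential in the depth L. -/
/-- The symmetrically normalized adjacency matrix
`Â = M^{-1/2} (I + A) M^{-1/2}`, where `M` is the diagonal matrix of row sums
(degrees) of `I + A`. -/
noncomputable def normalizedAdj (D : ℕ) (A : Matrix (Fin D) (Fin D) ℝ) :
    Matrix (Fin D) (Fin D) ℝ :=
  Matrix.diagonal (fun i => (Real.sqrt (∑ j, ((1 : Matrix (Fin D) (Fin D) ℝ) + A) i j))⁻¹) *
    ((1 : Matrix (Fin D) (Fin D) ℝ) + A) *
    Matrix.diagonal (fun i => (Real.sqrt (∑ j, ((1 : Matrix (Fin D) (Fin D) ℝ) + A) i j))⁻¹)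

/-- Feature dimensions of a GCN with input feature dimension `N` and all layer
output feature dimensions equal to `N'`. -/
def constDims (N N' : ℕ) : ℕ → ℕ := fun l => if l = 0 then N else N'

/-- interpolation by ReLU sums with integer thresholds -/
lemma relu_interp (F : ℕ → ℝ) (m : ℕ) : ∃ v : ℕ → ℝ, ∀ k : ℕ, 1 ≤ k → k ≤ m →
    ∑ q ∈ Finset.range m, v q * max 0 ((k : ℝ) - q) = F k := by
  induction m with
  | zero => exact ⟨fun _ => 0, fun k h1 h2 => by omega⟩
  | succ m ih =>
    obtain ⟨v, hv⟩ := ih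
    set S := ∑ q ∈ Finset.range m, v q * max 0 (((m + 1 : ℕ) : ℝ) - q) with hS
    refine ⟨Function.update v m (F (m+1) - S), fun k h1 h2 => ?_⟩
    rw [Finset.sum_range_succ, Function.update_self]
    have h : ∑ q ∈ Finset.range m, Function.update v m (F (m+1) - S) q * max 0 ((k : ℝ) - q)
        = ∑ q ∈ Finset.range m, v q * max 0 ((k : ℝ) - q) := by
      apply Finset.sum_congr rfl
      intro q hq
      rw [Function.update_of_ne]
      have := Finset.mem_range.1 hq
      omega
    rw [h]
    rcases Nat.lt_or_ge m k with hk | hk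
    · obtain rfl : k = m + 1 := by omega
      rw [← hS]
      push_cast
      rw [max_eq_right (by linarith)]
      ring
    · rw [hv k h1 hk, max_eq_left]
      · ring
      · have : (k : ℝ) ≤ m := by exact_mod_cast hk
        linarith

/-- zigzag function hitting each value on each cell -/
lemma zigzag (B : ℝ) (m : ℕ) : ∃ v : ℕ → ℝ, ∀ k : ℕ, 1 ≤ k → k + 1 ≤ m → ∀ t : ℝ, |t| < B →
    ∃ y : ℝ, (k : ℝ) < y ∧ y < k + 1 ∧
      ∑ q ∈ Finset.range m, v q * max 0 (y - q) = t := by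
  obtain ⟨v, hv⟩ := relu_interp (fun k => (-1) ^ k * B) m
  refine ⟨v, fun k h1 h2 t ht => ?_⟩
  have hc : Continuous (fun y : ℝ => ∑ q ∈ Finset.range m, v q * max 0 (y - q)) := by fun_prop
  have e1 := hv k h1 (by omega)
  have e2 := hv (k+1) (by omega) h2
  push_cast at e2
  have hkk : (k : ℝ) ≤ k + 1 := by linarith
  rw [abs_lt] at ht
  rcases neg_one_pow_eq_or ℝ k with hk | hk
  · have := intermediate_value_Ioo' hkk hc.continuousOn
      (show t ∈ Set.Ioo _ _ by
        constructor
        · beta_reduce; rw [e2, pow_succ, hk]; linarith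
        · beta_reduce; rw [e1, hk]; linarith)
    obtain ⟨y, hy, hy2⟩ := this
    exact ⟨y, hy.1, hy.2, hy2⟩
  · have := intermediate_value_Ioo hkk hc.continuousOn
      (show t ∈ Set.Ioo _ _ by
        constructor
        · beta_reduce; rw [e1, hk]; linarith
        · beta_reduce; rw [e2, pow_succ, hk]; linarith)
    obtain ⟨y, hy, hy2⟩ := this
    exact ⟨y, hy.1, hy.2, hy2⟩

lemma step_lemma (D m : ℕ) (Ahat : Matrix (Fin D) (Fin D) ℝ) (hinv : IsUnit Ahat) :
    ∃ v : ℕ → ℝ, ∀ (T : Fin D → ℕ → ℝ) (κ : Fin D → ℕ → ℕ),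
      (∀ i n, 0 < T i n ∧ T i n < m) → (∀ i n, 1 ≤ κ i n ∧ κ i n + 1 ≤ m) →
      ∃ Y : Fin D → ℕ → ℝ, (∀ i n, (κ i n : ℝ) < Y i n ∧ Y i n < κ i n + 1) ∧
        ∀ i n, ∑ p, Ahat i p * (∑ q ∈ Finset.range m, v q * max 0 (Y p n - q)) = T i n := by
  set B : ℝ := ∑ i, ∑ p, |Ahat⁻¹ i p| * m + 1 with hB
  obtain ⟨v, hv⟩ := zigzag B m
  refine ⟨v, fun T κ hT hκ => ?_⟩
  have hb : ∀ i n, |∑ p, Ahat⁻¹ i p * T p n| < B := by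
    intro i n
    have h1 : |∑ p, Ahat⁻¹ i p * T p n| ≤ ∑ p, |Ahat⁻¹ i p| * m := by
      refine (Finset.abs_sum_le_sum_abs _ _).trans (Finset.sum_le_sum fun p _ => ?_)
      rw [abs_mul]
      have := hT p n
      have h3 : |T p n| ≤ m := by rw [abs_of_pos this.1]; exact this.2.le
      gcongr
    have h2 : ∑ p, |Ahat⁻¹ i p| * m ≤ ∑ i, ∑ p, |Ahat⁻¹ i p| * (m : ℝ) :=
      Finset.single_le_sum (f := fun i => ∑ p, |Ahat⁻¹ i p| * (m : ℝ))
        (fun i _ => Finset.sum_nonneg fun p _ => by positivity) (Finset.mem_univ i)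
    linarith
  choose Y hY1 hY2 hY3 using fun i n => hv (κ i n) (hκ i n).1 (hκ i n).2 _ (hb i n)
  refine ⟨Y, fun i n => ⟨hY1 i n, hY2 i n⟩, fun i n => ?_⟩
  simp only [hY3]
  have hd : IsUnit Ahat.det := (Matrix.isUnit_iff_isUnit_det _).1 hinv
  have : Matrix.mulVec Ahat (Matrix.mulVec Ahat⁻¹ (fun p => T p n)) = fun p => T p n := by
    rw [Matrix.mulVec_mulVec, Matrix.mul_nonsing_inv _ hd, Matrix.one_mulVec]
  exact congrFun this i

lemma chain_lemma (D m : ℕ) (Ahat : Matrix (Fin D) (Fin D) ℝ) (v : ℕ → ℝ)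
    (hv : ∀ (T : Fin D → ℕ → ℝ) (κ : Fin D → ℕ → ℕ),
      (∀ i n, 0 < T i n ∧ T i n < m) → (∀ i n, 1 ≤ κ i n ∧ κ i n + 1 ≤ m) →
      ∃ Y : Fin D → ℕ → ℝ, (∀ i n, (κ i n : ℝ) < Y i n ∧ Y i n < κ i n + 1) ∧
        ∀ i n, ∑ p, Ahat i p * (∑ q ∈ Finset.range m, v q * max 0 (Y p n - q)) = T i n)
    (L : ℕ) : ∀ κ : ℕ → Fin D → ℕ → ℕ, (∀ l i n, 1 ≤ κ l i n ∧ κ l i n + 1 ≤ m) →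
      ∃ Y : ℕ → Fin D → ℕ → ℝ,
        (∀ l, l ≤ L → ∀ i n, (κ l i n : ℝ) < Y l i n ∧ Y l i n < κ l i n + 1) ∧
        ∀ l, l < L → ∀ i n, ∑ p, Ahat i p *
          (∑ q ∈ Finset.range m, v q * max 0 (Y l p n - q)) = Y (l+1) i n := by
  induction L with
  | zero =>
    intro κ hκ
    exact ⟨fun l i n => κ l i n + 1/2, fun l _ i n => ⟨by linarith, by linarith⟩,
      fun l hl => by omega⟩
  | succ L ih =>
    intro κ hκ
    obtain ⟨Y, hY1, hY2⟩ := ih (fun l => κ (l+1)) (fun l => hκ (l+1))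
    obtain ⟨Z, hZ1, hZ2⟩ := hv (Y 0) (κ 0) (fun i n => by
      have h1 := hY1 0 (by omega) i n
      have h2 := hκ (0+1) i n
      have h3 : ((κ (0+1) i n : ℝ)) + 1 ≤ m := by exact_mod_cast h2.2
      have h4 : (1:ℝ) ≤ ((κ (0+1) i n : ℝ)) := by exact_mod_cast h2.1
      constructor <;> linarith [h1.1, h1.2]) (hκ 0)
    refine ⟨fun l => Nat.casesOn l Z Y, ?_, ?_⟩
    · rintro (_ | l) hl
      · exact hZ1
      · exact hY1 l (by omega)
    · rintro (_ | l) hl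
      · exact hZ2
      · exact hY2 l (by omega)

lemma sum_reindex (N N' : ℕ) (hN : 1 ≤ N) (n : ℕ) (hn : n < N) (g : ℕ → ℝ) :
    ∑ a ∈ Finset.range N', (if a % N = n ∧ a / N < N' / N then g (a / N) else 0)
      = ∑ q ∈ Finset.range (N' / N), g q := by
  rw [← Finset.sum_filter]
  symm
  refine Finset.sum_bij (fun q _ => n + N * q) ?_ ?_ ?_ ?_
  · intro q hq
    have hq := Finset.mem_range.1 hq
    have h1 : N * (q + 1) ≤ N * (N' / N) := Nat.mul_le_mul_left _ hq
    have h2 := Nat.mul_div_le N' N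
    rw [Finset.mem_filter, Finset.mem_range, Nat.add_mul_mod_self_left, Nat.mod_eq_of_lt hn,
      Nat.add_mul_div_left _ _ hN, Nat.div_eq_of_lt hn]
    refine ⟨by rw [mul_add] at h1; omega, rfl, by omega⟩
  · intro a _ b _ h
    have : N * a = N * b := by simpa using h
    exact Nat.eq_of_mul_eq_mul_left hN this
  · intro a ha
    rw [Finset.mem_filter] at ha
    refine ⟨a / N, Finset.mem_range.2 ha.2.2, ?_⟩
    rw [← ha.2.1]
    exact Nat.mod_add_div a N
  · intro q _
    rw [Nat.add_mul_div_left _ _ hN, Nat.div_eq_of_lt hn, zero_add]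

lemma gcnZ_eq (D L N N' : ℕ) (hN : 1 ≤ N) (Ahat : Matrix (Fin D) (Fin D) ℝ)
    (Nd : ℕ → ℕ) (h0 : Nd 0 = N) (hs : ∀ l, Nd (l+1) = N') (v : ℕ → ℝ)
    (W : ∀ l : ℕ, Matrix (Fin (Nd l)) (Fin (Nd (l + 1))) ℝ)
    (b : ∀ l : ℕ, Fin (Nd (l + 1)) → ℝ)
    (hW0 : ∀ a j, W 0 a j = if (a : ℕ) = (j : ℕ) % N then 1 else 0)
    (hW : ∀ l a j, W (l+1) a j = if (a : ℕ) % N = (j : ℕ) % N ∧ (a : ℕ) / N < N' / N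
      then v ((a : ℕ) / N) else 0)
    (hb : ∀ l j, b l j = - (((j : ℕ) / N : ℕ) : ℝ))
    (Y : ℕ → Fin D → ℕ → ℝ)
    (hY : ∀ l, l < L → ∀ i n, ∑ p, Ahat i p *
          (∑ q ∈ Finset.range (N' / N), v q * max 0 (Y l p n - q)) = Y (l+1) i n)
    (X0 : Matrix (Fin D) (Fin (Nd 0)) ℝ)
    (hX : ∀ i n, (Ahat * X0) i n = Y 0 i n) :
    ∀ l, l ≤ L → ∀ i j, gcnZ D Ahat Nd W b X0 l i j
      = Y l i ((j : ℕ) % N) - (((j : ℕ) / N : ℕ) : ℝ) := by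
  intro l
  induction l with
  | zero =>
    intro _ i j
    have hj : (j : ℕ) % N < Nd 0 := by rw [h0]; exact Nat.mod_lt _ hN
    simp only [gcnZ, gcnX, Matrix.of_apply, hb]
    rw [Matrix.mul_apply, Finset.sum_eq_single (⟨(j : ℕ) % N, hj⟩ : Fin (Nd 0))]
    · rw [hX, hW0]; simp; ring
    · intro a _ ha
      rw [hW0, if_neg, mul_zero]
      intro h
      exact ha (Fin.ext h)
    · intro h; exact absurd (Finset.mem_univ _) h
  | succ l ih =>
    intro hl i j
    have ih := ih (by omega)
    have hXl : ∀ p a, gcnX D Ahat Nd W b X0 (l+1) p a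
        = max 0 (Y l p ((a : ℕ) % N) - (((a : ℕ) / N : ℕ) : ℝ)) := by
      intro p a
      rw [← ih]
      rfl
    have key : ∀ p, (gcnX D Ahat Nd W b X0 (l+1) * W (l+1)) p j
        = ∑ q ∈ Finset.range (N' / N), v q * max 0 (Y l p ((j : ℕ) % N) - q) := by
      intro p
      rw [Matrix.mul_apply, ← sum_reindex N N' hN ((j : ℕ) % N) (Nat.mod_lt _ hN)
        (fun q => v q * max 0 (Y l p ((j : ℕ) % N) - q)),
        ← congrArg Finset.range (hs l), Finset.sum_range]
      apply Finset.sum_congr rfl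
      intro a _
      rw [hXl, hW]
      split_ifs with h
      · rw [h.1, mul_comm]
      · rw [mul_zero]
    simp only [gcnZ, Matrix.of_apply, hb]
    rw [Matrix.mul_assoc, Matrix.mul_apply, ← hY l (by omega)]
    simp only [key]
    ring

lemma patterns_finite (D L : ℕ) (Nd : ℕ → ℕ) :
    {P : ∀ l : Fin L, Fin D → Fin (Nd ((l : ℕ) + 1)) → ℝ |
      ∀ l i j, P l i j = 1 ∨ P l i j = -1}.Finite := by
  have : {P : ∀ l : Fin L, Fin D → Fin (Nd ((l : ℕ) + 1)) → ℝ |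
      ∀ l i j, P l i j = 1 ∨ P l i j = -1} =
      Set.pi Set.univ (fun l => Set.pi Set.univ (fun i => Set.pi Set.univ
        (fun j => ({1, -1} : Set ℝ)))) := by
    ext P
    simp [Set.mem_pi]
  rw [this]
  exact Set.Finite.pi (fun l => Set.Finite.pi (fun i => Set.Finite.pi
    (fun j => Set.toFinite ({1, -1} : Set ℝ))))

lemma regions_ge (D L N N' : ℕ) (hN : 1 ≤ N) (hN' : 2 ≤ N' / N)
    (Ahat : Matrix (Fin D) (Fin D) ℝ) (hinv : IsUnit Ahat)
    (Nd : ℕ → ℕ) (h0 : Nd 0 = N) (hs : ∀ l, Nd (l+1) = N') :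
    ∃ (W : ∀ l : ℕ, Matrix (Fin (Nd l)) (Fin (Nd (l + 1))) ℝ)
      (b : ∀ l : ℕ, Fin (Nd (l + 1)) → ℝ),
      (N' / N - 1) ^ (L * N * D) ≤ gcnRegions D L Ahat Nd W b := by
  obtain ⟨v, hv⟩ := step_lemma D (N' / N) Ahat hinv
  let W : ∀ l : ℕ, Matrix (Fin (Nd l)) (Fin (Nd (l + 1))) ℝ := fun l =>
    match l with
    | 0 => fun a j => if (a : ℕ) = (j : ℕ) % N then 1 else 0
    | l+1 => fun a j => if (a : ℕ) % N = (j : ℕ) % N ∧ (a : ℕ) / N < N' / N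
      then v ((a : ℕ) / N) else 0
  let b : ∀ l : ℕ, Fin (Nd (l + 1)) → ℝ := fun l j => - (((j : ℕ) / N : ℕ) : ℝ)
  refine ⟨W, b, ?_⟩
  let Φ : (Fin L → Fin D → Fin N → Fin (N' / N - 1)) →
      (∀ l : Fin L, Fin D → Fin (Nd ((l : ℕ) + 1)) → ℝ) := fun κ l i j =>
    if (j : ℕ) / N ≤ (κ l i ⟨(j : ℕ) % N, Nat.mod_lt _ hN⟩ : ℕ) + 1 then 1 else -1
  have hlt : ∀ n k : ℕ, n < N → k < N' / N → n + N * k < N' := by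
    intro n k hn hk
    have h1 : N * (k + 1) ≤ N * (N' / N) := Nat.mul_le_mul_left _ hk
    have h2 := Nat.mul_div_le N' N
    rw [mul_add] at h1
    omega
  have hle : ∀ κ κ', Φ κ = Φ κ' → ∀ l i n, (κ l i n : ℕ) ≤ κ' l i n := by
    intro κ κ' h l i n
    have hk := (κ l i n).2
    have hj : (n : ℕ) + N * ((κ l i n : ℕ) + 1) < Nd ((l : ℕ) + 1) := by
      rw [hs]; exact hlt _ _ n.2 (by omega)
    have := congrFun (congrFun (congrFun h l) i) ⟨_, hj⟩
    simp only [Φ, Nat.add_mul_mod_self_left, Nat.mod_eq_of_lt n.2,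
      Nat.add_mul_div_left _ _ hN, Nat.div_eq_of_lt n.2, zero_add, le_refl, if_true,
      Fin.eta] at this
    by_contra hcon
    rw [if_neg (by omega)] at this
    norm_num at this
  have hinj : Function.Injective Φ := by
    intro κ κ' h
    funext l i n
    exact Fin.ext (le_antisymm (hle _ _ h l i n) (hle _ _ h.symm l i n))
  have hcard : (N' / N - 1) ^ (L * N * D) = (Set.range Φ).ncard := by
    rw [← Set.image_univ, Set.ncard_image_of_injective _ hinj, Set.ncard_univ,
      Nat.card_eq_fintype_card]
    simp only [Fintype.card_pi, Fintype.card_fin, Finset.prod_const, Finset.card_univ, ← pow_mul]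
    congr 1
    ring
  rw [hcard]
  refine Set.ncard_le_ncard ?_ ((patterns_finite D L Nd).subset fun P hP => hP.1)
  rintro _ ⟨κ, rfl⟩
  refine ⟨fun l i j => by simp only [Φ]; split_ifs <;> simp, ?_⟩
  let κ' : ℕ → Fin D → ℕ → ℕ := fun l i n =>
    if h : l < L ∧ n < N then (κ ⟨l, h.1⟩ i ⟨n, h.2⟩ : ℕ) + 1 else 1
  have hκ' : ∀ l i n, 1 ≤ κ' l i n ∧ κ' l i n + 1 ≤ N' / N := by
    intro l i n
    simp only [κ']
    split_ifs with h
    · have := (κ ⟨l, h.1⟩ i ⟨n, h.2⟩).2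
      omega
    · omega
  obtain ⟨Y, hY1, hY2⟩ := chain_lemma D (N' / N) Ahat v hv L κ' hκ'
  have hd : IsUnit Ahat.det := (Matrix.isUnit_iff_isUnit_det _).1 hinv
  refine ⟨Ahat⁻¹ * Matrix.of (fun i (n : Fin (Nd 0)) => Y 0 i n), fun l i j => ?_⟩
  have hZ := gcnZ_eq D L N N' hN Ahat Nd h0 hs v W b (fun _ _ => rfl) (fun _ _ _ => rfl)
    (fun _ _ => rfl) Y hY2 (Ahat⁻¹ * Matrix.of (fun i (n : Fin (Nd 0)) => Y 0 i n))
    (fun i n => by rw [← Matrix.mul_assoc, Matrix.mul_nonsing_inv _ hd, Matrix.one_mul]; rfl)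
    l (by omega) i j
  rw [hZ]
  have hc := hY1 l (by omega) i ((j : ℕ) % N)
  have hk : κ' l i ((j : ℕ) % N) = (κ l i ⟨(j : ℕ) % N, Nat.mod_lt _ hN⟩ : ℕ) + 1 := by
    simp only [κ']
    rw [dif_pos ⟨l.2, Nat.mod_lt _ hN⟩]
  simp only [Φ]
  rw [← hk]
  split_ifs with h
  · have : (((j : ℕ) / N : ℕ) : ℝ) ≤ (κ' l i ((j : ℕ) % N) : ℝ) := by exact_mod_cast h
    linarith [hc.1]
  · have : (κ' l i ((j : ℕ) % N) : ℝ) + 1 ≤ (((j : ℕ) / N : ℕ) : ℝ) := by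
      exact_mod_cast Nat.lt_of_not_le h
    linarith [hc.2]

/-- with `Â` the (invertible) normalized adjacency matrix of a graph on
`D` nodes, `L ≥ 1` layers, input dimension `D × N` and all hidden widths `N'`, the
maximal number of linear regions `R(N')` over all parameters satisfies
`R(N') ≥ c (N')^{L N D}` for all large `N'` and some constant `c > 0`. -/
theorem deep_gcn_region_growth
    (D L N : ℕ) (hD : 0 < D) (hL : 1 ≤ L) (hN : 1 ≤ N)
    (A : Matrix (Fin D) (Fin D) ℝ)
    (h01 : ∀ i j, A i j = 0 ∨ A i j = 1) (hsymm : A.IsSymm)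
    (hinv : IsUnit (normalizedAdj D A)) :
    ∃ c : ℝ, 0 < c ∧ ∃ M₀ : ℕ, ∀ N' : ℕ, M₀ ≤ N' →
      c * (N' : ℝ) ^ (L * N * D) ≤
        (sSup {r : ℕ |
          ∃ (W : ∀ l : ℕ, Matrix (Fin (constDims N N' l)) (Fin (constDims N N' (l + 1))) ℝ)
            (b : ∀ l : ℕ, Fin (constDims N N' (l + 1)) → ℝ),
            r = gcnRegions D L (normalizedAdj D A) (constDims N N') W b} : ℕ) := by
  refine ⟨(1 / (2 * N : ℝ)) ^ (L * N * D), by positivity, 3 * N, fun N' hN' => ?_⟩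
  have hm : 3 ≤ N' / N := (Nat.le_div_iff_mul_le hN).2 hN'
  obtain ⟨W, b, hWb⟩ := regions_ge D L N N' hN (by omega) (normalizedAdj D A) hinv
    (constDims N N') (by simp [constDims]) (fun l => by simp [constDims])
  have hbdd : BddAbove {r : ℕ |
          ∃ (W : ∀ l : ℕ, Matrix (Fin (constDims N N' l)) (Fin (constDims N N' (l + 1))) ℝ)
            (b : ∀ l : ℕ, Fin (constDims N N' (l + 1)) → ℝ),
            r = gcnRegions D L (normalizedAdj D A) (constDims N N') W b} := by
    refine ⟨Set.ncard {P : ∀ l : Fin L, Fin D → Fin (constDims N N' ((l : ℕ) + 1)) → ℝ |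
      ∀ l i j, P l i j = 1 ∨ P l i j = -1}, ?_⟩
    · rintro r ⟨W, b, rfl⟩
      exact Set.ncard_le_ncard (fun P hP => hP.1) (patterns_finite D L (constDims N N'))
  have h1 := le_csSup hbdd ⟨W, b, rfl⟩
  have h2 := hWb.trans h1
  have h3 : N' ≤ 2 * N * (N' / N - 1) := by
    have h4 := Nat.lt_mul_div_succ N' (show 0 < N from hN)
    obtain ⟨q, hq⟩ : ∃ q, N' / N = q + 3 := ⟨N' / N - 3, by omega⟩
    rw [hq] at h4 ⊢
    have : q + 3 - 1 = q + 2 := by omega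
    rw [this]
    nlinarith
  have h5 : (N' : ℝ) ≤ 2 * N * ((N' / N - 1 : ℕ) : ℝ) := by exact_mod_cast h3
  have hNp : (0 : ℝ) < 2 * N := by positivity
  rw [← mul_pow]
  calc (1 / (2 * N : ℝ) * N') ^ (L * N * D)
      ≤ ((N' / N - 1 : ℕ) : ℝ) ^ (L * N * D) := by
        gcongr
        rw [one_div, inv_mul_le_iff₀ hNp]
        exact h5
    _ ≤ _ := by exact_mod_cast h2
end

section
/- Let m, n be positive integers, V_1,...,V_m nonzero linear subspaces of \mathbb{R}^n, and n_1,...,n_m nonnegative integers. Let \mathcal{A} = {H_{kj} : 1 \le k \le m, 1 \le j \le n_k} be an arrangement of hyperplanes H_{kj} = {x \in \mathbb{R}^n : \langle \alpha_{kj}, x\rangle = b_{kj}} with 0 \ne \alpha_{kj} \in V_k and b_{kj} \in \mathbb{R}. Let K_{V;V_1,...,V_m} = {(i_1,...,i_m) \in \mathbb{N}^m : for every subset J \subseteq \{1,...,m\}, \sum_{k\in J} i_k \le \dim(\sum_{k\in J} V_k)}. Then the number r(\mathcal{A}) of regions of the arrangement satisfies r(\mathcal{A}) \le \sum_{(i_1,...,i_m)\in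 K_{V;V_1,...,V_m}} \prod_{k=1}^{m} \binom{n_k}{i_k}. -/
open scoped Classical

lemma aux_indep {E : Type*} [DecidableEq E] {n : ℕ} (a : E → Fin n → ℝ) (b : E → ℝ)
    (A : Finset (Finset E))
    (hA : ∀ U ∈ A, ∃ x : Fin n → ℝ, ∀ e, (e ∈ U → b e < ∑ t, a e t * x t) ∧
      (e ∉ U → ∑ t, a e t * x t < b e))
    (S : Finset E) (hS : A.Shatters S) : LinearIndepOn ℝ a (S : Set E) := by
  rw [linearIndepOn_finset_iff]
  intro g hg
  by_contra hcon
  push Not at hcon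
  obtain ⟨e0, he0, hne⟩ := hcon
  have key : ∀ x : Fin n → ℝ, ∑ e ∈ S, g e * (∑ t, a e t * x t - b e) = -∑ e ∈ S, g e * b e := by
    intro x
    have h0 : ∑ e ∈ S, g e * (∑ t, a e t * x t) = 0 := by
      have : ∑ t, (∑ e ∈ S, g e • a e) t * x t = 0 := by rw [hg]; simp
      rw [← this]
      simp only [Finset.sum_apply, Pi.smul_apply, smul_eq_mul, Finset.sum_mul, Finset.mul_sum]
      rw [Finset.sum_comm]
      simp only [mul_assoc]
    simp only [mul_sub, Finset.sum_sub_distrib, h0, zero_sub]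
  obtain ⟨U, hU, hUS⟩ := hS (Finset.filter_subset (fun e => 0 < g e) S)
  obtain ⟨W, hW, hWS⟩ := hS (Finset.filter_subset (fun e => g e < 0) S)
  obtain ⟨x, hx⟩ := hA U hU
  obtain ⟨y, hy⟩ := hA W hW
  have memU : ∀ e ∈ S, (e ∈ U ↔ 0 < g e) := by
    intro e he
    have := Finset.ext_iff.1 hUS e
    simpa [he] using this
  have memW : ∀ e ∈ S, (e ∈ W ↔ g e < 0) := by
    intro e he
    have := Finset.ext_iff.1 hWS e
    simpa [he] using this
  have px : ∀ e ∈ S, g e ≠ 0 → 0 < g e * (∑ t, a e t * x t - b e) := by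
    intro e he h
    rcases lt_or_gt_of_ne h with h | h
    · exact mul_pos_of_neg_of_neg h (sub_neg.2 ((hx e).2 (fun h' => by
        have := (memU e he).1 h'; linarith)))
    · exact mul_pos h (sub_pos.2 ((hx e).1 ((memU e he).2 h)))
  have py : ∀ e ∈ S, g e ≠ 0 → g e * (∑ t, a e t * y t - b e) < 0 := by
    intro e he h
    rcases lt_or_gt_of_ne h with h | h
    · exact mul_neg_of_neg_of_pos h (sub_pos.2 ((hy e).1 ((memW e he).2 h)))
    · exact mul_neg_of_pos_of_neg h (sub_neg.2 ((hy e).2 (fun h' => by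
        have := (memW e he).1 h'; linarith)))
  have h1 : 0 < ∑ e ∈ S, g e * (∑ t, a e t * x t - b e) := by
    apply Finset.sum_pos'
    · intro e he
      by_cases h : g e = 0
      · simp [h]
      · exact (px e he h).le
    · exact ⟨e0, he0, px e0 he0 hne⟩
  have h2 : ∑ e ∈ S, g e * (∑ t, a e t * y t - b e) < 0 := by
    apply Finset.sum_neg'
    · intro e he
      by_cases h : g e = 0
      · simp [h]
      · exact (py e he h).le
    · exact ⟨e0, he0, py e0 he0 hne⟩
  rw [key] at h1 h2
  linarith

lemma aux_conn {E : Type*} {n : ℕ} (a : E → Fin n → ℝ) (b : E → ℝ)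
    (P : (Fin n → ℝ) → Prop) (hP : ∀ x, P x ↔ ∀ e, ∑ t, a e t * x t ≠ b e)
    (x y : {x // P x})
    (h : ∀ e, b e < ∑ t, a e t * x.1 t ↔ b e < ∑ t, a e t * y.1 t) :
    (x : ConnectedComponents {x // P x}) = (y : ConnectedComponents {x // P x}) := by
  have lin : ∀ (e : E) (s r : ℝ), ∑ t, a e t * (s • x.1 + r • y.1) t
      = s * ∑ t, a e t * x.1 t + r * ∑ t, a e t * y.1 t := by
    intro e s r
    rw [Finset.mul_sum, Finset.mul_sum, ← Finset.sum_add_distrib]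
    refine Finset.sum_congr rfl fun t _ => ?_
    simp; ring
  have hseg : segment ℝ x.1 y.1 ⊆ {x | P x} := by
    rintro z ⟨s, r, hs, hr, hsr, rfl⟩
    refine (hP _).2 fun e => ?_
    rw [lin]
    have hx := (hP _).1 x.2 e
    have hy := (hP _).1 y.2 e
    have hr' : r = 1 - s := by linarith
    subst hr'
    rcases lt_or_gt_of_ne hx with h1 | h1
    · have h2 : ∑ t, a e t * y.1 t < b e :=
        lt_of_le_of_ne (not_lt.1 fun h' => absurd ((h e).2 h') (not_lt.2 h1.le)) hy
      apply ne_of_lt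
      rcases hs.eq_or_lt with h0 | h0
      · subst h0; linarith
      · nlinarith [mul_pos h0 (sub_pos.2 h1), mul_nonneg hr (sub_pos.2 h2).le]
    · have h2 := (h e).1 h1
      apply ne_of_gt
      rcases hs.eq_or_lt with h0 | h0
      · subst h0; linarith
      · nlinarith [mul_pos h0 (sub_pos.2 h1), mul_nonneg hr (sub_pos.2 h2).le]
  rw [ConnectedComponents.coe_eq_coe']
  have hpre : IsPreconnected ((↑) ⁻¹' segment ℝ x.1 y.1 : Set {x // P x}) := by
    have hc : IsPreconnected (segment ℝ x.1 y.1) := (convex_segment _ _).isPreconnected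
    refine (Topology.IsInducing.subtypeVal (t := {x | P x})).isPreconnected_image.1 ?_
    have him : (Subtype.val '' (Subtype.val ⁻¹' segment ℝ x.1 y.1 : Set {x // P x}))
        = segment ℝ x.1 y.1 := by
      ext z
      constructor
      · rintro ⟨w, hw, rfl⟩
        exact hw
      · intro hz
        exact ⟨⟨z, hseg hz⟩, hz, rfl⟩
    exact him.symm ▸ hc
  exact hpre.subset_connectedComponent (right_mem_segment ℝ x.1 y.1) (left_mem_segment ℝ x.1 y.1)

/-- upper bound of the generalized Zaslavsky-type theorem:
for an arrangement of hyperplanes `H_{kj} = {x : ⟨α_{kj}, x⟩ = b_{kj}}` with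
`0 ≠ α_{kj} ∈ V_k`, the number of regions (connected components of the complement)
is at most `∑_{i ∈ K} ∏_k (n_k choose i_k)`, where
`K = {i ∈ ℕ^m : ∀ J ⊆ [m], ∑_{k∈J} i_k ≤ dim (∑_{k∈J} V_k)}`.
(Every `i ∈ K` satisfies `i_k ≤ n`, so `K` is identified with the sign-compatible
tuples in `(Fin (n+1))^m`.) -/
theorem arrangement_region_upper_bound
    (m n : ℕ) (hm : 0 < m) (hn : 0 < n)
    (V : Fin m → Submodule ℝ (Fin n → ℝ)) (hV : ∀ k, V k ≠ ⊥)
    (nk : Fin m → ℕ)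
    (α : ∀ k : Fin m, Fin (nk k) → (Fin n → ℝ))
    (hα : ∀ k j, α k j ≠ 0 ∧ α k j ∈ V k)
    (b : ∀ k : Fin m, Fin (nk k) → ℝ) :
    Nat.card (ConnectedComponents
        {x : Fin n → ℝ // ∀ (k : Fin m) (j : Fin (nk k)), ∑ t, α k j t * x t ≠ b k j})
      ≤ ∑ i : Fin m → Fin (n + 1),
          if ∀ J : Finset (Fin m),
              ∑ k ∈ J, (i k : ℕ) ≤ Module.finrank ℝ ↥(⨆ k ∈ J, V k)
          then ∏ k, (nk k).choose (i k) else 0 := by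
  let a : (Σ k, Fin (nk k)) → Fin n → ℝ := fun e => α e.1 e.2
  let c : (Σ k, Fin (nk k)) → ℝ := fun e => b e.1 e.2
  let A : Finset (Finset (Σ k, Fin (nk k))) := Finset.univ.filter fun U =>
    ∃ x : Fin n → ℝ, ∀ e, (e ∈ U → c e < ∑ t, a e t * x t) ∧ (e ∉ U → ∑ t, a e t * x t < c e)
  have hA : ∀ U ∈ A, ∃ x : Fin n → ℝ, ∀ e, (e ∈ U → c e < ∑ t, a e t * x t) ∧
      (e ∉ U → ∑ t, a e t * x t < c e) := fun U hU => (Finset.mem_filter.1 hU).2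
  have step1 : Nat.card (ConnectedComponents
        {x : Fin n → ℝ // ∀ (k : Fin m) (j : Fin (nk k)), ∑ t, α k j t * x t ≠ b k j})
      ≤ A.card := by
    let sg : {x : Fin n → ℝ // ∀ (k : Fin m) (j : Fin (nk k)), ∑ t, α k j t * x t ≠ b k j} → A :=
      fun x => ⟨Finset.univ.filter fun e => c e < ∑ t, a e t * x.1 t, by
        refine Finset.mem_filter.2 ⟨Finset.mem_univ _, x.1, fun e => ⟨fun h => ?_, fun h => ?_⟩⟩
        · simpa using h
        · have h' : ∑ t, a e t * x.1 t ≤ c e := by simpa using h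
          exact lt_of_le_of_ne h' (x.2 e.1 e.2)⟩
    have hinj : Function.Injective (fun q : ConnectedComponents
        {x : Fin n → ℝ // ∀ (k : Fin m) (j : Fin (nk k)), ∑ t, α k j t * x t ≠ b k j} =>
        sg (Function.surjInv ConnectedComponents.surjective_coe q)) := by
      intro p q hpq
      rw [← Function.surjInv_eq ConnectedComponents.surjective_coe p,
        ← Function.surjInv_eq ConnectedComponents.surjective_coe q]
      refine aux_conn a c _ (fun x => ⟨fun h e => h e.1 e.2, fun h k j => h ⟨k, j⟩⟩) _ _ fun e => ?_
      have := Finset.ext_iff.1 (Subtype.ext_iff.1 hpq) e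
      simpa [sg] using this
    have := Nat.card_le_card_of_injective _ hinj
    simpa using this
  have step2 : A.card ≤ A.shatterer.card := Finset.card_le_card_shatterer A
  refine step1.trans (step2.trans ?_)
  rw [← Finset.sum_filter]
  have hsub : A.shatterer ⊆ (Finset.univ.filter fun i : Fin m → Fin (n + 1) =>
      ∀ J : Finset (Fin m), ∑ k ∈ J, (i k : ℕ) ≤ Module.finrank ℝ ↥(⨆ k ∈ J, V k)).biUnion
      fun i => (Fintype.piFinset fun k =>
        Finset.powersetCard (i k : ℕ) (Finset.univ : Finset (Fin (nk k)))).image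
          fun T => Finset.univ.sigma T := by
    intro S hS
    rw [Finset.mem_shatterer] at hS
    let T : ∀ k, Finset (Fin (nk k)) := fun k => Finset.univ.filter fun j => (⟨k, j⟩ : Σ k, Fin (nk k)) ∈ S
    have hST : Finset.univ.sigma T = S := by
      ext ⟨k, j⟩; simp [T]
    have hK : ∀ J : Finset (Fin m), ∑ k ∈ J, (T k).card ≤ Module.finrank ℝ ↥(⨆ k ∈ J, V k) := by
      intro J
      have hJ : A.Shatters (J.sigma T) := hS.mono_right (by
        rw [← hST]; exact Finset.sigma_mono (Finset.subset_univ _) fun _ => le_rfl)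
      have hli := aux_indep a c A hA _ hJ
      have h1 := finrank_span_eq_card (show LinearIndependent ℝ
        (fun e : (J.sigma T : Finset _) => a e.1) from hli)
      rw [← Finset.card_sigma, ← Fintype.card_coe, ← h1]
      apply Submodule.finrank_mono
      rw [Submodule.span_le]
      rintro _ ⟨e, rfl⟩
      have he := (Finset.mem_sigma.1 e.2).1
      exact (le_iSup₂_of_le (f := fun k (_ : k ∈ J) => V k) e.1.1 he le_rfl) (hα e.1.1 e.1.2).2
    have hle : ∀ k, (T k).card < n + 1 := by
      intro k
      have := hK {k}
      have h2 := Submodule.finrank_le (⨆ l ∈ ({k} : Finset (Fin m)), V l)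
      rw [Finset.sum_singleton] at this
      rw [Module.finrank_fin_fun] at h2
      omega
    refine Finset.mem_biUnion.2 ⟨fun k => ⟨(T k).card, hle k⟩, ?_, ?_⟩
    · exact Finset.mem_filter.2 ⟨Finset.mem_univ _, hK⟩
    · refine Finset.mem_image.2 ⟨T, ?_, hST⟩
      simp
  refine (Finset.card_le_card hsub).trans (Finset.card_biUnion_le.trans ?_)
  refine Finset.sum_le_sum fun i _ => Finset.card_image_le.trans ?_
  simp
end

section
/- Let m, n be positive integers, V_1,...,V_m nonzero linear subspaces of \mathbb{R}^n, n_1,...,n_m nonnegative integers, and \mathcal{A} = {H_{kj}} an arrangement of hyperplanes H_{kj} = {x \in \mathbb{R}^n : \langle \alpha_{kj}, x\rangle = b_{kj}} with 0 \ne \alpha_{kj} \in V_k and b_{kj} \in \mathbb{R}. Let K_{V;V_1,...,V_m} = {(i_1,...,i_m) \in \mathbb{N}^m : for every subset J \subseteq \{1,...,m\}, \sum_{k\in J} i_k \le \dim(\sum_{k\in J} V_k)}. Assume: (i) for each (i_1,...,i_m) \in K_{V;V_1,...,V_m}, any collection of \sum_k i_k vectors obtained by choosing i_k distinct vectors from {\alpha_{kj}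 : 1 \le j \le n_k} for each k is linearly independent; and (ii) for each (i_1,...,i_m) \in \mathbb{N}^m \setminus K_{V;V_1,...,V_m}, the intersection of any collection of hyperplanes obtained by choosing i_k distinct hyperplanes from {H_{kj} : 1 \le j \le n_k} for each k is empty. Then r(\mathcal{A}) = \sum_{(i_1,...,i_m)\in K_{V;V_1,...,V_m}} \prod_{k=1}^{m} \binom{n_k}{i_k}. -/
open scoped Classical

def CellP {ι E : Type*} (f : ι → E → ℝ) (b : ι → ℝ) (S I P : Finset ι) (x : E) : Prop :=
  (∀ i ∈ S, f i x = b i) ∧ (∀ i ∈ P, b i < f i x) ∧ (∀ i ∈ I, i ∉ P → f i x < b i)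

noncomputable def cells {ι E : Type*} (f : ι → E → ℝ) (b : ι → ℝ) (S I : Finset ι) :
    Finset (Finset ι) :=
  I.powerset.filter (fun P => ∃ x, CellP f b S I P x)

noncomputable def centrals {ι E : Type*} (f : ι → E → ℝ) (b : ι → ℝ) (S I : Finset ι) :
    Finset (Finset ι) :=
  I.powerset.filter (fun T => ∃ x, ∀ i ∈ S ∪ T, f i x = b i)

theorem card_filter_insert_powerset {ι : Type*} (a : ι) (I : Finset ι) (ha : a ∉ I)
    (p : Finset ι → Prop) :
    ((insert a I).powerset.filter p).card
      = (I.powerset.filter p).card + (I.powerset.filter (fun P => p (insert a P))).card := by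
  rw [Finset.powerset_insert, Finset.filter_union, Finset.card_union_of_disjoint]
  · congr 1
    rw [Finset.filter_image, Finset.card_image_of_injOn]
    intro P hP Q hQ h
    simp only [Finset.coe_filter, Finset.mem_powerset, Set.mem_ofPred_eq] at hP hQ
    have h1 : a ∉ P := fun h => ha (hP.1 h)
    have h2 : a ∉ Q := fun h => ha (hQ.1 h)
    rw [← Finset.erase_insert h1, h, Finset.erase_insert h2]
  · rw [Finset.disjoint_left]
    intro P hP hQ
    simp only [Finset.mem_filter, Finset.mem_powerset, Finset.mem_image] at hP hQ
    obtain ⟨⟨Q, _, rfl⟩, _⟩ := hQ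
    exact ha (hP.1 (Finset.mem_insert_self _ _))

theorem perturb {ι E : Type*} [AddCommGroup E] [Module ℝ E] (f : ι → E →ₗ[ℝ] ℝ) (b : ι → ℝ)
    (S I P : Finset ι) (a : ι) (haS : a ∉ S) (hP : P ⊆ I) (x : E)
    (hx : CellP (fun i => f i) b S I P x) (hxa : f a x = b a)
    (h : ∀ c : ι → ℝ, ∃ x, ∀ i ∈ insert a S, f i x = c i) (σ : ℝ) :
    ∃ ε > 0, ∃ y, CellP (fun i => f i) b S I P y ∧ f a y = b a + ε * σ := by
  obtain ⟨d, hd⟩ := h (fun i => if i = a then σ else 0)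
  have hda : f a d = σ := by simpa using hd a (Finset.mem_insert_self _ _)
  have hds : ∀ i ∈ S, f i d = 0 := by
    intro i hi
    have := hd i (Finset.mem_insert_of_mem hi)
    have hne : i ≠ a := by rintro rfl; exact haS hi
    rwa [if_neg hne] at this
  obtain ⟨h1, h2, h3⟩ := hx
  have hc : ∀ i, Filter.Tendsto (fun ε : ℝ => f i (x + ε • d)) (nhdsWithin 0 (Set.Ioi 0))
      (nhds (f i x)) := by
    intro i
    have : Continuous (fun ε : ℝ => f i (x + ε • d)) := by
      simp only [map_add, map_smul, smul_eq_mul]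
      fun_prop
    have h0 := (this.tendsto 0).mono_left (nhdsWithin_le_nhds (s := Set.Ioi (0 : ℝ)))
    simpa using h0
  have e2 : ∀ᶠ ε : ℝ in nhdsWithin 0 (Set.Ioi 0), ∀ i ∈ P, b i < f i (x + ε • d) := by
    rw [Filter.eventually_all_finset]
    intro i hi
    exact (hc i).eventually (lt_mem_nhds (h2 i hi))
  have e3 : ∀ᶠ ε : ℝ in nhdsWithin 0 (Set.Ioi 0), ∀ i ∈ I, i ∉ P → f i (x + ε • d) < b i := by
    rw [Filter.eventually_all_finset]
    intro i hi
    by_cases hiP : i ∈ P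
    · simp [hiP]
    · filter_upwards [(hc i).eventually (gt_mem_nhds (h3 i hi hiP))] with ε hε _ using hε
  obtain ⟨ε, ⟨h2', h3'⟩, hε⟩ := ((e2.and e3).and self_mem_nhdsWithin).exists
  refine ⟨ε, hε, x + ε • d, ⟨?_, h2', h3'⟩, ?_⟩
  · intro i hi
    have := h1 i hi
    simp only at this
    simp [hds i hi, this]
  · simp [hxa, hda]

theorem crossing {ι E : Type*} [AddCommGroup E] [Module ℝ E] (f : ι → E →ₗ[ℝ] ℝ) (b : ι → ℝ)
    (S I P : Finset ι) (a : ι) (x y : E)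
    (hx : CellP (fun i => f i) b S I P x) (hy : CellP (fun i => f i) b S I P y)
    (hxa : f a x < b a) (hya : b a < f a y) :
    ∃ z, CellP (fun i => f i) b S I P z ∧ f a z = b a := by
  obtain ⟨x1, x2, x3⟩ := hx
  obtain ⟨y1, y2, y3⟩ := hy
  have hpos : 0 < f a y - f a x := by linarith
  obtain ⟨s, t, hs, ht, hst, hv⟩ : ∃ s t : ℝ, 0 < s ∧ 0 < t ∧ s + t = 1 ∧
      s * f a x + t * f a y = b a := by
    refine ⟨(f a y - b a) / (f a y - f a x), (b a - f a x) / (f a y - f a x),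
      div_pos (by linarith) hpos, div_pos (by linarith) hpos, ?_, ?_⟩
    · field_simp; ring
    · field_simp; ring
  refine ⟨s • x + t • y, ⟨?_, ?_, ?_⟩, by simpa using hv⟩
  · intro i hi
    have h1 := x1 i hi
    have h2 := y1 i hi
    simp only at h1 h2
    simp only [map_add, map_smul, smul_eq_mul, h1, h2]
    rw [← add_mul, hst, one_mul]
  · intro i hi
    have h1 := x2 i hi
    have h2 := y2 i hi
    simp only [map_add, map_smul, smul_eq_mul] at h1 h2 ⊢
    have : b i = s * b i + t * b i := by rw [← add_mul, hst, one_mul]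
    nlinarith [mul_lt_mul_of_pos_left h1 hs, mul_lt_mul_of_pos_left h2 ht]
  · intro i hi hi'
    have h1 := x3 i hi hi'
    have h2 := y3 i hi hi'
    simp only [map_add, map_smul, smul_eq_mul] at h1 h2 ⊢
    have : b i = s * b i + t * b i := by rw [← add_mul, hst, one_mul]
    nlinarith [mul_lt_mul_of_pos_left h1 hs, mul_lt_mul_of_pos_left h2 ht]

theorem cells_card_eq {ι E : Type*} [AddCommGroup E] [Module ℝ E] (f : ι → E →ₗ[ℝ] ℝ)
    (b : ι → ℝ) (I : Finset ι) : ∀ (S : Finset ι), Disjoint S I →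
    (∀ T ⊆ S ∪ I, (∃ x, ∀ i ∈ T, f i x = b i) → ∀ c : ι → ℝ, ∃ x, ∀ i ∈ T, f i x = c i) →
    (cells (fun i => f i) b S I).card = (centrals (fun i => f i) b S I).card := by
  induction I using Finset.induction_on with
  | empty =>
    intro S _ _
    unfold cells centrals CellP
    congr 1
    ext P
    simp only [Finset.powerset_empty, Finset.mem_filter, Finset.mem_singleton]
    constructor
    · rintro ⟨rfl, x, hx⟩
      exact ⟨rfl, x, by simpa using hx⟩
    · rintro ⟨rfl, x, hx⟩
      exact ⟨rfl, x, by simpa using hx⟩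
  | insert a I ha ih =>
    intro S hd h
    have haS : a ∉ S := fun h => Finset.disjoint_left.1 hd h (Finset.mem_insert_self _ _)
    have hd1 : Disjoint S I := hd.mono_right (Finset.subset_insert _ _)
    have hd2 : Disjoint (insert a S) I := by
      rw [Finset.disjoint_insert_left]; exact ⟨ha, hd1⟩
    have e1 := ih S hd1 (fun T hT => h T (hT.trans
      (Finset.union_subset_union_right (Finset.subset_insert _ _))))
    have e2 := ih (insert a S) hd2 (fun T hT => h T (hT.trans (by
      intro i; simp only [Finset.mem_union, Finset.mem_insert]; tauto)))
    have c1 : (centrals (fun i => f i) b S (insert a I)).card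
        = (centrals (fun i => f i) b S I).card
          + (centrals (fun i => f i) b (insert a S) I).card := by
      unfold centrals
      rw [card_filter_insert_powerset a I ha]
      simp only [Finset.union_insert, Finset.insert_union]
    have c2 : (cells (fun i => f i) b S (insert a I)).card
        = (cells (fun i => f i) b S I).card
          + (cells (fun i => f i) b (insert a S) I).card := by
      unfold cells
      rw [card_filter_insert_powerset a I ha, ← Finset.card_union_add_card_inter]
      have key : ∀ P ⊆ I, ∀ x, CellP (fun i => f i) b S I P x → f a x = b a → ∀ σ : ℝ,
          ∃ ε > 0, ∃ y, CellP (fun i => f i) b S I P y ∧ f a y = b a + ε * σ := by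
        intro P hP x hx hxa
        refine perturb f b S I P a haS hP x hx hxa (h (insert a S) ?_ ⟨x, ?_⟩)
        · intro i; simp only [Finset.mem_union, Finset.mem_insert]; tauto
        · intro i hi
          rcases Finset.mem_insert.1 hi with rfl | hi
          · exact hxa
          · exact hx.1 i hi
      have eneg : ∀ P ⊆ I, ∀ x, CellP (fun i => f i) b S (insert a I) P x ↔
          CellP (fun i => f i) b S I P x ∧ f a x < b a := by
        intro P hP x
        have haP : a ∉ P := fun h => ha (hP h)
        unfold CellP
        simp only [Finset.forall_mem_insert]
        tauto
      have epos : ∀ P ⊆ I, ∀ x, CellP (fun i => f i) b S (insert a I) (insert a P) x ↔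
          CellP (fun i => f i) b S I P x ∧ b a < f a x := by
        intro P hP x
        have haP : a ∉ P := fun h => ha (hP h)
        unfold CellP
        rw [Finset.forall_mem_insert, Finset.forall_mem_insert]
        simp only [Finset.mem_insert, not_or]
        constructor
        · rintro ⟨h1, ⟨h2, h3⟩, h4, h5⟩
          exact ⟨⟨h1, h3, fun i hi hi' => h5 i hi ⟨fun h => ha (h ▸ hi), hi'⟩⟩, h2⟩
        · rintro ⟨⟨h1, h3, h5⟩, h2⟩
          exact ⟨h1, ⟨h2, h3⟩, fun h => absurd trivial h.1, fun i hi hi' => h5 i hi hi'.2⟩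
      have eeq : ∀ P, ∀ x, CellP (fun i => f i) b (insert a S) I P x ↔
          CellP (fun i => f i) b S I P x ∧ f a x = b a := by
        intro P x
        unfold CellP
        simp only [Finset.forall_mem_insert]
        tauto
      congr 2
      · ext P
        simp only [Finset.mem_union, Finset.mem_filter, Finset.mem_powerset]
        rw [← and_or_left]
        refine and_congr_right fun hP => ?_
        simp only [eneg P hP, epos P hP]
        constructor
        · rintro (⟨x, hx, _⟩ | ⟨x, hx, _⟩) <;> exact ⟨x, hx⟩
        · rintro ⟨x, hx⟩
          rcases lt_trichotomy (f a x) (b a) with hl | he | hg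
          · exact Or.inl ⟨x, hx, hl⟩
          · obtain ⟨ε, hε, y, hy, hy'⟩ := key P hP x hx he 1
            exact Or.inr ⟨y, hy, by rw [hy']; linarith⟩
          · exact Or.inr ⟨x, hx, hg⟩
      · ext P
        simp only [Finset.mem_inter, Finset.mem_filter, Finset.mem_powerset]
        rw [← and_and_left]
        refine and_congr_right fun hP => ?_
        simp only [eneg P hP, epos P hP, eeq P]
        constructor
        · rintro ⟨⟨x, hx, hx'⟩, ⟨y, hy, hy'⟩⟩
          exact crossing f b S I P a x y hx hy hx' hy'
        · rintro ⟨x, hx, hxa⟩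
          obtain ⟨ε, hε, y, hy, hy'⟩ := key P hP x hx hxa 1
          obtain ⟨ε', hε', z, hz, hz'⟩ := key P hP x hx hxa (-1)
          exact ⟨⟨z, hz, by rw [hz']; linarith⟩, ⟨y, hy, by rw [hy']; linarith⟩⟩
    rw [c1, c2, e1, e2]

theorem card_cc_of_fibers {X D : Type*} [TopologicalSpace X] (g : X → D)
    (hg : IsLocallyConstant g) (hf : ∀ x, IsPreconnected {y | g y = g x}) :
    Nat.card (ConnectedComponents X) = Nat.card (Set.range g) := by
  refine Nat.card_congr (Equiv.ofBijective (Quotient.lift (fun x => (⟨g x, x, rfl⟩ : Set.range g))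
    ?_) ⟨?_, ?_⟩)
  · intro x y hxy
    have hxy : connectedComponent x = connectedComponent y := hxy
    have hy : y ∈ connectedComponent x := hxy ▸ mem_connectedComponent
    exact Subtype.ext (hg.apply_eq_of_isPreconnected isPreconnected_connectedComponent
      mem_connectedComponent hy)
  · intro p q
    refine Quotient.inductionOn₂ p q fun x y h => ?_
    have h : g x = g y := congrArg Subtype.val h
    exact Quotient.sound (connectedComponent_eq
      ((hf x).subset_connectedComponent rfl h.symm))
  · rintro ⟨_, x, rfl⟩
    exact ⟨Quotient.mk _ x, rfl⟩

theorem regions_card {ι : Type*} [Fintype ι] {n : ℕ} (f : ι → (Fin n → ℝ) →ₗ[ℝ] ℝ) (b : ι → ℝ) :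
    Nat.card (ConnectedComponents {x : Fin n → ℝ // ∀ i, f i x ≠ b i})
      = (cells (fun i => f i) b ∅ Finset.univ).card := by
  have hcont : ∀ i, Continuous (f i) := fun i => (f i).continuous_of_finiteDimensional
  let g : {x : Fin n → ℝ // ∀ i, f i x ≠ b i} → Finset ι :=
    fun x => Finset.univ.filter (fun i => b i < f i x.1)
  have hgm : ∀ x i, i ∈ g x ↔ b i < f i x.1 := by intro x i; simp [g]
  rw [card_cc_of_fibers g]
  · have : Set.range g = (cells (fun i => f i) b ∅ Finset.univ : Set (Finset ι)) := by
      ext P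
      simp only [cells, CellP, Set.mem_range, Finset.coe_filter, Finset.mem_powerset,
        Set.mem_ofPred_eq, Finset.subset_univ, true_and, Finset.notMem_empty, false_imp_iff,
        implies_true, Finset.mem_univ, true_imp_iff]
      constructor
      · rintro ⟨x, rfl⟩
        refine ⟨x.1, fun i hi => (hgm x i).1 hi, fun i hi => ?_⟩
        rw [hgm] at hi
        exact lt_of_le_of_ne (not_lt.1 hi) (x.2 i)
      · rintro ⟨x, h1, h2⟩
        refine ⟨⟨x, fun i => ?_⟩, ?_⟩
        · by_cases hi : i ∈ P
          · exact (h1 i hi).ne'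
          · exact (h2 i hi).ne
        · ext i
          rw [hgm]
          refine ⟨fun h => ?_, h1 i⟩
          by_contra hi
          exact lt_asymm h (h2 i hi)
    rw [this]
    simp
  · rw [IsLocallyConstant.iff_eventually_eq]
    intro x
    have : ∀ᶠ y in nhds x, ∀ i, (b i < f i y.1 ↔ b i < f i x.1) := by
      rw [Filter.eventually_all]
      intro i
      have hc : Filter.Tendsto (fun y : {x : Fin n → ℝ // ∀ i, f i x ≠ b i} => f i y.1) (nhds x)
          (nhds (f i x.1)) := ((hcont i).comp continuous_subtype_val).tendsto x
      rcases lt_or_gt_of_ne (x.2 i) with h | h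
      · filter_upwards [hc.eventually (gt_mem_nhds h)] with y hy
        exact ⟨fun h' => absurd h' hy.le.not_gt, fun h' => absurd h' h.le.not_gt⟩
      · filter_upwards [hc.eventually (lt_mem_nhds h)] with y hy
        exact ⟨fun _ => h, fun _ => hy⟩
    filter_upwards [this] with y hy
    ext i
    rw [hgm, hgm, hy i]
  · intro x
    refine (Topology.IsInducing.isPreconnected_image (f := Subtype.val) ⟨rfl⟩).1 ?_
    apply Convex.isPreconnected
    have : Subtype.val '' {y | g y = g x} =
        ⋂ i, (if b i < f i x.1 then {z | b i < f i z} else {z | f i z < b i}) := by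
      ext z
      simp only [Set.mem_image, Set.mem_ofPred_eq, Set.mem_iInter]
      constructor
      · rintro ⟨y, hy, rfl⟩ i
        have := (hgm y i).symm.trans (by rw [hy, hgm])
        split_ifs with h
        · exact this.2 h
        · exact lt_of_le_of_ne (not_lt.1 (fun h' => h (this.1 h'))) (y.2 i)
      · intro hz
        have hz' : ∀ i, f i z ≠ b i := by
          intro i
          have := hz i
          split_ifs at this with h
          · exact ne_of_gt this
          · exact ne_of_lt this
        refine ⟨⟨z, hz'⟩, ?_, rfl⟩
        ext i
        rw [hgm, hgm]
        have := hz i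
        split_ifs at this with h
        · exact ⟨fun _ => h, fun _ => this⟩
        · exact ⟨fun h' => absurd h' (le_of_lt this).not_gt, fun h' => absurd h' h⟩
    rw [this]
    apply convex_iInter
    intro i
    split_ifs
    · exact convex_halfSpace_gt (f i).isLinear _
    · exact convex_halfSpace_lt (f i).isLinear _

theorem solve_of_li {κ : Type*} {n : ℕ} (v : κ → Fin n → ℝ) (hv : LinearIndependent ℝ v)
    (c : κ → ℝ) : ∃ x : Fin n → ℝ, ∀ i, ∑ t, v i t * x t = c i := by
  obtain ⟨l, hl⟩ := LinearMap.exists_leftInverse_of_injective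
    (Finsupp.linearCombination ℝ v) (LinearMap.ker_eq_bot.2 hv)
  let g := (Finsupp.linearCombination ℝ c) ∘ₗ l
  refine ⟨fun t => g (Pi.single t 1), fun i => ?_⟩
  have h1 : g (v i) = c i := by
    have := LinearMap.congr_fun hl (Finsupp.single i 1)
    simp at this
    simp [g, this]
  rw [← h1, LinearMap.pi_apply_eq_sum_univ g (v i)]
  refine Finset.sum_congr rfl fun t _ => ?_
  rw [smul_eq_mul]
  congr 1
  refine congrArg g ?_
  funext s
  simp [Pi.single_apply, eq_comm]

/-- equality case of the generalized Zaslavsky-type theorem: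
for an arrangement of hyperplanes `H_{kj} = {x : ⟨α_{kj}, x⟩ = b_{kj}}` with
`0 ≠ α_{kj} ∈ V_k`, if
(i) for each `i ∈ K`, every choice of `i_k` distinct normal vectors from
    `{α_{kj} : j}` for each `k` yields a linearly independent family, and
(ii) for each `i ∉ K`, every choice of `i_k` distinct hyperplanes from
    `{H_{kj} : j}` for each `k` has empty intersection,
then the number of regions (connected components of the complement) equals
`∑_{i ∈ K} ∏_k (n_k choose i_k)`, where
`K = {i ∈ ℕ^m : ∀ J ⊆ [m], ∑_{k∈J} i_k ≤ dim (∑_{k∈J} V_k)}`. -/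
theorem arrangement_region_count_eq
    (m n : ℕ) (hm : 0 < m) (hn : 0 < n)
    (V : Fin m → Submodule ℝ (Fin n → ℝ)) (hV : ∀ k, V k ≠ ⊥)
    (nk : Fin m → ℕ)
    (α : ∀ k : Fin m, Fin (nk k) → (Fin n → ℝ))
    (hα : ∀ k j, α k j ≠ 0 ∧ α k j ∈ V k)
    (b : ∀ k : Fin m, Fin (nk k) → ℝ)
    (hind : ∀ i : Fin m → ℕ,
      (∀ J : Finset (Fin m), ∑ k ∈ J, i k ≤ Module.finrank ℝ ↥(⨆ k ∈ J, V k)) →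
      ∀ T : ∀ k : Fin m, Finset (Fin (nk k)), (∀ k, (T k).card = i k) →
        LinearIndependent ℝ (fun p : Σ k : Fin m, {j // j ∈ T k} => α p.1 p.2))
    (hempty : ∀ i : Fin m → ℕ,
      ¬ (∀ J : Finset (Fin m), ∑ k ∈ J, i k ≤ Module.finrank ℝ ↥(⨆ k ∈ J, V k)) →
      ∀ T : ∀ k : Fin m, Finset (Fin (nk k)), (∀ k, (T k).card = i k) →
        ¬ ∃ x : Fin n → ℝ, ∀ k : Fin m, ∀ j ∈ T k, ∑ t, α k j t * x t = b k j) :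
    Nat.card (ConnectedComponents
        {x : Fin n → ℝ // ∀ (k : Fin m) (j : Fin (nk k)), ∑ t, α k j t * x t ≠ b k j})
      = ∑ i : Fin m → Fin (n + 1),
          if ∀ J : Finset (Fin m),
              ∑ k ∈ J, (i k : ℕ) ≤ Module.finrank ℝ ↥(⨆ k ∈ J, V k)
          then ∏ k, (nk k).choose (i k) else 0 := by
  let f : (Σ k : Fin m, Fin (nk k)) → (Fin n → ℝ) →ₗ[ℝ] ℝ :=
    fun p => ∑ t, α p.1 p.2 t • LinearMap.proj t
  let B : (Σ k : Fin m, Fin (nk k)) → ℝ := fun p => b p.1 p.2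
  have hf : ∀ p x, f p x = ∑ t, α p.1 p.2 t * x t := by
    intro p x
    simp [f, LinearMap.sum_apply]
  let K : (Fin m → ℕ) → Prop := fun i =>
    ∀ J : Finset (Fin m), ∑ k ∈ J, i k ≤ Module.finrank ℝ ↥(⨆ k ∈ J, V k)
  have hsol : ∀ T : ∀ k : Fin m, Finset (Fin (nk k)), K (fun k => (T k).card) →
      ∀ c : (Σ k : Fin m, Fin (nk k)) → ℝ, ∃ x, ∀ p ∈ Finset.univ.sigma T, f p x = c p := by
    intro T hT c
    obtain ⟨x, hx⟩ := solve_of_li _ (hind _ hT T (fun _ => rfl)) (fun p => c ⟨p.1, p.2⟩)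
    refine ⟨x, ?_⟩
    rintro ⟨k, j⟩ hp
    rw [hf]
    exact hx ⟨k, ⟨j, (Finset.mem_sigma.1 hp).2⟩⟩
  have hK : ∀ T : ∀ k : Fin m, Finset (Fin (nk k)),
      (∃ x, ∀ p ∈ Finset.univ.sigma T, f p x = B p) → K (fun k => (T k).card) := by
    rintro T ⟨x, hx⟩
    by_contra hc
    refine hempty _ hc T (fun _ => rfl) ⟨x, fun k j hj => ?_⟩
    rw [← hf ⟨k, j⟩]
    exact hx ⟨k, j⟩ (by simpa using hj)
  let e : Finset (Σ k : Fin m, Fin (nk k)) → ∀ k, Finset (Fin (nk k)) :=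
    fun T k => Finset.univ.filter (fun j => (⟨k, j⟩ : Σ k : Fin m, Fin (nk k)) ∈ T)
  have he : ∀ T, Finset.univ.sigma (e T) = T := by
    intro T; ext ⟨k, j⟩; simp [e]
  have he' : ∀ T, e (Finset.univ.sigma T) = T := by
    intro T; funext k; ext j; simp [e]
  have hX : Nat.card (ConnectedComponents
        {x : Fin n → ℝ // ∀ (k : Fin m) (j : Fin (nk k)), ∑ t, α k j t * x t ≠ b k j})
      = Nat.card (ConnectedComponents {x : Fin n → ℝ // ∀ p, f p x ≠ B p}) := by
    have : (fun x : Fin n → ℝ => ∀ (k : Fin m) (j : Fin (nk k)), ∑ t, α k j t * x t ≠ b k j)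
        = fun x => ∀ p, f p x ≠ B p := by
      funext x
      simp only [hf, B, Sigma.forall]
    rw [this]
  rw [hX, regions_card, cells_card_eq f B Finset.univ ∅ (Finset.disjoint_empty_left _)]
  swap
  · intro T _ hT c
    rw [← he T] at hT ⊢
    exact hsol _ (hK _ hT) c
  have hcard : (centrals (fun i => f i) B ∅ Finset.univ).card
      = (Finset.univ.filter (fun T : ∀ k, Finset (Fin (nk k)) => K (fun k => (T k).card))).card := by
    refine Finset.card_bij' (fun T _ => e T) (fun T _ => Finset.univ.sigma T) ?_ ?_
      (fun T _ => he T) (fun T _ => he' T)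
    · intro T hT
      simp only [centrals, Finset.mem_filter, Finset.empty_union] at hT
      simp only [Finset.mem_filter, Finset.mem_univ, true_and]
      apply hK
      rw [he]
      exact hT.2
    · intro T hT
      simp only [Finset.mem_filter, Finset.mem_univ, true_and] at hT
      simp only [centrals, Finset.mem_filter, Finset.empty_union]
      exact ⟨by simp, hsol T hT B⟩
  rw [hcard]
  have hle : ∀ i, K i → ∀ k, i k < n + 1 := by
    intro i hi k
    have h1 := hi {k}
    have h2 := Submodule.finrank_le (⨆ k' ∈ ({k} : Finset (Fin m)), V k')
    rw [Finset.sum_singleton] at h1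
    rw [Module.finrank_fin_fun] at h2
    omega
  rw [Finset.card_eq_sum_card_fiberwise (f := fun T k => Fin.ofNat (n + 1) (T k).card)
    (t := Finset.univ) (fun _ _ => Finset.mem_coe.2 (Finset.mem_univ _))]
  refine Finset.sum_congr rfl fun i _ => ?_
  have hiff : ∀ T : ∀ k, Finset (Fin (nk k)), K (fun k => (T k).card) →
      (((fun k => Fin.ofNat (n + 1) (T k).card) = i) ↔ ∀ k, (T k).card = i k) := by
    intro T hT
    rw [funext_iff]
    refine forall_congr' fun k => ?_
    rw [Fin.ext_iff, Fin.val_ofNat, Nat.mod_eq_of_lt (hle _ hT k)]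
  split_ifs with hi
  · have : (fun k => (nk k).choose (i k))
        = fun k => (Finset.powersetCard (i k) (Finset.univ : Finset (Fin (nk k)))).card := by
      funext k; simp
    rw [this, ← Fintype.card_piFinset]
    congr 1
    ext T
    simp only [Finset.mem_filter, Finset.mem_univ, true_and, Fintype.mem_piFinset,
      Finset.mem_powersetCard, Finset.subset_univ]
    constructor
    · rintro ⟨h1, h2⟩
      exact (hiff T h1).1 h2
    · intro h
      have h1 : K (fun k => (T k).card) := by
        have : (fun k => (T k).card) = fun k => (i k : ℕ) := funext h
        rw [this]; exact hi
      exact ⟨h1, (hiff T h1).2 h⟩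
  · rw [Finset.card_eq_zero, Finset.eq_empty_iff_forall_notMem]
    intro T hT
    simp only [Finset.mem_filter, Finset.mem_univ, true_and] at hT
    apply hi
    have : (fun k => (T k).card) = fun k => (i k : ℕ) := funext ((hiff T hT.1).1 hT.2)
    have h1 := hT.1
    rw [this] at h1
    exact h1
end
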